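/- arXiv:2409.06915 — 3 statements merged into one kernel-verified Lean document; each statement's English description precedes it below -/
import Mathlib

section
/- A ground state u changes concavity exactly once: there exists a unique r* > 0 with u''(r*) = 0, and u'' < 0 on (0, r*) while u'' > 0 on (r*, ∞). Moreover, if u is a solution of the IVP that changes sign and c < z are consecutive points with u'(c) = 0 (or c = 0) and z the smallest zero of u larger than c, then u'' has exactly one zero in the interval (c, z). -/
open Real Filter Set

/-- The nonlinearity `f(s) = -s + |s|^(p-1) s`. -/
noncomputable def f (p s : ℝ) : ℝ := -s + |s| ^ (p - 1) * s

/-- The derivative of the nonlinearity, `f'(s) = -1 + p |s|^(p-1)`. -/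
noncomputable def fder (p s : ℝ) : ℝ := -1 + p * |s| ^ (p - 1)

/-- The primitive `F(s) = -s^2/2 + |s|^(p+1)/(p+1)`. -/
noncomputable def F (p s : ℝ) : ℝ := -s ^ 2 / 2 + |s| ^ (p + 1) / (p + 1)

/-- `u : [0,∞) → ℝ` (modeled on `Set.Ici 0`) is a C² solution of the IVP
`u'' + ((n-1)/r) u' + f(u) = 0`, `u(0) = α`, `u'(0) = 0`; the data `u'`, `u''`
are its first and second derivatives on `[0,∞)`. -/
structure IsSolution (n : ℕ) (p α : ℝ) (u u' u'' : ℝ → ℝ) : Prop where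
  init : u 0 = α
  initDeriv : u' 0 = 0
  hasDeriv1 : ∀ r ∈ Set.Ici (0:ℝ), HasDerivWithinAt u (u' r) (Set.Ici 0) r
  hasDeriv2 : ∀ r ∈ Set.Ici (0:ℝ), HasDerivWithinAt u' (u'' r) (Set.Ici 0) r
  cont2 : ContinuousOn u'' (Set.Ici 0)
  ode : ∀ r : ℝ, 0 < r → u'' r + ((n : ℝ) - 1) / r * u' r + f p (u r) = 0

/-- The variation `v` associated with a solution `u`: the C² solution of the linearized
equation `v'' + ((n-1)/r) v' + f'(u) v = 0`, `v(0) = 1`, `v'(0) = 0`. -/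
structure IsVariation (n : ℕ) (p : ℝ) (u v v' v'' : ℝ → ℝ) : Prop where
  init : v 0 = 1
  initDeriv : v' 0 = 0
  hasDeriv1 : ∀ r ∈ Set.Ici (0:ℝ), HasDerivWithinAt v (v' r) (Set.Ici 0) r
  hasDeriv2 : ∀ r ∈ Set.Ici (0:ℝ), HasDerivWithinAt v' (v'' r) (Set.Ici 0) r
  cont2 : ContinuousOn v'' (Set.Ici 0)
  ode : ∀ r : ℝ, 0 < r → v'' r + ((n : ℝ) - 1) / r * v' r + fder p (u r) * v r = 0

/-- `u` is decaying: `u(r) → 0` and `u'(r) → 0` as `r → ∞`. -/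
def Decaying (u u' : ℝ → ℝ) : Prop :=
  Filter.Tendsto u Filter.atTop (nhds 0) ∧ Filter.Tendsto u' Filter.atTop (nhds 0)

/-- `u` changes sign on `(0,∞)`. -/
def ChangesSign (u : ℝ → ℝ) : Prop :=
  (∃ r : ℝ, 0 < r ∧ u r < 0) ∧ (∃ r : ℝ, 0 < r ∧ 0 < u r)

/-- `z 0 < z 1 < ⋯ < z (k-1)` are exactly the zeros of `u` in `(0,∞)`. -/
def ExactZeros (u : ℝ → ℝ) (k : ℕ) (z : Fin k → ℝ) : Prop :=
  StrictMono z ∧ (∀ i, 0 < z i ∧ u (z i) = 0) ∧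
    ∀ r : ℝ, 0 < r → u r = 0 → ∃ i, r = z i

lemma f_eq_of_nonneg (p : ℝ) {s : ℝ} (hs : 0 ≤ s) : f p s = s * (s ^ (p - 1) - 1) := by
  rw [f, abs_of_nonneg hs]; ring

lemma F_eq_of_nonneg {p s : ℝ} (hp : 1 < p) (hs : 0 ≤ s) :
    F p s = s ^ 2 * (s ^ (p - 1) / (p + 1) - 1 / 2) := by
  have h : s ^ (p + 1) = s ^ (p - 1) * s ^ 2 := by
    rw [← Real.rpow_add_natCast' hs (by push_cast; linarith)]
    congr 1; push_cast; ring
  rw [F, abs_of_nonneg hs, h]; ring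

lemma f_neg (p s : ℝ) : f p (-s) = -f p s := by
  rw [f, f, abs_neg]; ring

lemma F_zero {p : ℝ} (hp : 1 < p) : F p 0 = 0 := by
  simp [F_eq_of_nonneg hp le_rfl]

lemma continuous_f {p : ℝ} (hp : 1 < p) : Continuous (f p) := by
  have h : Continuous fun s : ℝ => |s| ^ (p - 1) :=
    continuous_abs.rpow_const fun _ => Or.inr (by linarith)
  exact continuous_neg.add (h.mul continuous_id)

lemma hasDerivAt_F {p : ℝ} (hp : 1 < p) (s : ℝ) : HasDerivAt (F p) (f p s) s := by
  have h1 := (hasDerivAt_abs_rpow s (by linarith : 1 < p + 1)).div_const (p + 1)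
  have h2 := ((hasDerivAt_id s).pow 2).neg.div_const 2
  refine (h2.add h1).congr_deriv ?_
  have h3 : p + 1 ≠ 0 := by linarith
  rw [f, show p + 1 - 2 = p - 1 by ring]
  simp only [id]
  field_simp
  push_cast
  ring

lemma hasDerivAt_f {p s : ℝ} (hs : 0 < s) : HasDerivAt (f p) (p * s ^ (p - 1) - 1) s := by
  have h1 : HasDerivAt (fun t : ℝ => -t + t ^ p) (-1 + p * s ^ (p - 1)) s :=
    (hasDerivAt_neg s).add (Real.hasDerivAt_rpow_const (Or.inl hs.ne'))
  refine (h1.congr_of_eventuallyEq ?_).congr_deriv (by ring)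
  filter_upwards [lt_mem_nhds hs] with t ht
  have h2 : t ^ p = t ^ (p - 1) * t := by
    rw [← Real.rpow_add_one ht.ne']; congr 1; ring
  rw [f, abs_of_pos ht, h2]

lemma f_pos {p s : ℝ} (hp : 1 < p) (hs : 1 < s) : 0 < f p s := by
  rw [f_eq_of_nonneg p (by linarith)]
  have := Real.one_lt_rpow hs (by linarith : 0 < p - 1)
  exact mul_pos (by linarith) (by linarith)

lemma f_nonpos {p s : ℝ} (hp : 1 < p) (h0 : 0 ≤ s) (h1 : s ≤ 1) : f p s ≤ 0 := by
  rw [f_eq_of_nonneg p h0]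
  have := Real.rpow_le_one h0 h1 (by linarith : 0 ≤ p - 1)
  exact mul_nonpos_of_nonneg_of_nonpos h0 (by linarith)

lemma one_lt_of_F_nonneg {p s : ℝ} (hp : 1 < p) (h0 : 0 < s) (hF : 0 ≤ F p s) : 1 < s := by
  by_contra! h1
  have hX := Real.rpow_le_one h0.le h1 (by linarith : 0 ≤ p - 1)
  rw [F_eq_of_nonneg hp h0.le] at hF
  have hq : s ^ (p - 1) / (p + 1) < 1 / 2 := by
    rw [div_lt_div_iff₀ (by linarith) (by norm_num)]; linarith
  nlinarith [pow_pos h0 2]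

/-- The energy `u'^2 / 2 + F(u)`. -/
noncomputable def energy (p : ℝ) (u u' : ℝ → ℝ) (r : ℝ) : ℝ := u' r ^ 2 / 2 + F p (u r)

/-- The Pohozaev functional `r^n (u'^2 / 2 + F(u)) + (n-2)/2 r^(n-1) u u'`. -/
noncomputable def pohozaev (n : ℕ) (p : ℝ) (u u' : ℝ → ℝ) (r : ℝ) : ℝ :=
  r ^ (n - 1) * (r * energy p u u' r + ((n : ℝ) - 2) / 2 * (u r * u' r))

namespace IsSolution

variable {n : ℕ} {p α : ℝ} {u u' u'' : ℝ → ℝ}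

lemma neg (hu : IsSolution n p α u u' u'') :
    IsSolution n p (-α) (fun r => -u r) (fun r => -u' r) (fun r => -u'' r) where
  init := by rw [hu.init]
  initDeriv := by rw [hu.initDeriv, neg_zero]
  hasDeriv1 r hr := (hu.hasDeriv1 r hr).neg
  hasDeriv2 r hr := (hu.hasDeriv2 r hr).neg
  cont2 := hu.cont2.neg
  ode r hr := by rw [f_neg]; linarith [hu.ode r hr]

lemma hasDerivAt (hu : IsSolution n p α u u' u'') {r : ℝ} (hr : 0 < r) :
    HasDerivAt u (u' r) r :=
  (hu.hasDeriv1 r hr.le).hasDerivAt (Ici_mem_nhds hr)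

lemma hasDerivAt' (hu : IsSolution n p α u u' u'') {r : ℝ} (hr : 0 < r) :
    HasDerivAt u' (u'' r) r :=
  (hu.hasDeriv2 r hr.le).hasDerivAt (Ici_mem_nhds hr)

lemma continuousOn (hu : IsSolution n p α u u' u'') : ContinuousOn u (Ici 0) :=
  fun r hr => (hu.hasDeriv1 r hr).continuousWithinAt

lemma continuousOn' (hu : IsSolution n p α u u' u'') : ContinuousOn u' (Ici 0) :=
  fun r hr => (hu.hasDeriv2 r hr).continuousWithinAt

lemma mul_ode (hu : IsSolution n p α u u' u'') {r : ℝ} (hr : 0 < r) :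
    r * u'' r + ((n : ℝ) - 1) * u' r + r * f p (u r) = 0 := by
  have h := hu.ode r hr
  field_simp at h
  linarith

lemma mul_secondDeriv_zero (hu : IsSolution n p α u u' u'') (hp : 1 < p) :
    (n : ℝ) * u'' 0 = -f p (u 0) := by
  have hs : Tendsto (fun r => u' r / r) (nhdsWithin 0 (Ioi 0)) (nhds (u'' 0)) := by
    have h := (hasDerivWithinAt_iff_tendsto_slope.1 (hu.hasDeriv2 0 self_mem_Ici))
    rw [Ici_sdiff_left] at h
    refine h.congr fun r => ?_
    rw [slope_def_field, hu.initDeriv, sub_zero, sub_zero]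
  have h2 : Tendsto u'' (nhdsWithin 0 (Ioi 0)) (nhds (u'' 0)) :=
    (hu.cont2 0 self_mem_Ici).mono_left (nhdsWithin_mono _ Ioi_subset_Ici_self)
  have h3 : Tendsto (fun r => f p (u r)) (nhdsWithin 0 (Ioi 0)) (nhds (f p (u 0))) :=
    ((continuous_f hp).tendsto _).comp
      ((hu.continuousOn 0 self_mem_Ici).mono_left (nhdsWithin_mono _ Ioi_subset_Ici_self))
  have h4 := (h2.add (hs.const_mul ((n : ℝ) - 1))).add h3
  have h5 := h4.congr' (f₂ := fun _ => (0 : ℝ)) (by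
    filter_upwards [self_mem_nhdsWithin] with r hr
    rw [← hu.ode r hr]; ring)
  have h6 := tendsto_nhds_unique h5 tendsto_const_nhds
  linarith

lemma hasDerivAt_energy (hu : IsSolution n p α u u' u'') (hp : 1 < p) {r : ℝ} (hr : 0 < r) :
    HasDerivAt (energy p u u') (-(((n : ℝ) - 1) / r * u' r ^ 2)) r := by
  have h1 := (((hu.hasDerivAt' hr).pow 2).div_const 2).add
    ((hasDerivAt_F hp (u r)).comp r (hu.hasDerivAt hr))
  refine h1.congr_deriv ?_
  have h := hu.ode r hr
  have h2 : u'' r = -(((n : ℝ) - 1) / r * u' r) - f p (u r) := by linarith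
  rw [h2]; push_cast; ring

lemma continuousOn_energy (hu : IsSolution n p α u u' u'') (hp : 1 < p) :
    ContinuousOn (energy p u u') (Ici 0) :=
  ((hu.continuousOn'.pow 2).div_const 2).add
    ((continuous_iff_continuousAt.2 fun s => (hasDerivAt_F hp s).continuousAt).comp_continuousOn
      hu.continuousOn)

lemma antitoneOn_energy (hu : IsSolution n p α u u' u'') (hn : 3 ≤ n) (hp : 1 < p) :
    AntitoneOn (energy p u u') (Ici 0) := by
  have hn' : (3 : ℝ) ≤ n := by exact_mod_cast hn
  refine antitoneOn_of_hasDerivWithinAt_nonpos (convex_Ici 0) (hu.continuousOn_energy hp)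
    (fun r hr => (hu.hasDerivAt_energy hp (by simpa using hr)).hasDerivWithinAt) fun r hr => ?_
  have hr' : 0 < r := by simpa using hr
  have : 0 ≤ ((n : ℝ) - 1) / r * u' r ^ 2 :=
    mul_nonneg (div_nonneg (by linarith) hr'.le) (sq_nonneg _)
  linarith

lemma one_lt_of_critical (hp : 1 < p) {r : ℝ} (hpos : 0 < u r)
    (hE : 0 ≤ energy p u u' r) (hc : u' r = 0) : 1 < u r := by
  refine one_lt_of_F_nonneg hp hpos ?_
  simpa [energy, hc] using hE

/-- At a critical point of nonnegative energy in a positivity region, `u` is strictly concave. -/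
lemma secondDeriv_neg_of_critical (hu : IsSolution n p α u u' u'') (hn : 3 ≤ n) (hp : 1 < p)
    {r : ℝ} (hr : 0 ≤ r) (hpos : 0 < u r) (hE : 0 ≤ energy p u u' r) (hc : u' r = 0) :
    u'' r < 0 := by
  have hf := f_pos hp (one_lt_of_critical hp hpos hE hc)
  rcases hr.eq_or_lt with rfl | hr
  · have h := hu.mul_secondDeriv_zero hp
    have hn' : (3 : ℝ) ≤ n := by exact_mod_cast hn
    by_contra! h0
    nlinarith
  · have h := hu.ode r hr
    rw [hc] at h
    linarith

lemma deriv_nonpos (hu : IsSolution n p α u u' u'') (hn : 3 ≤ n) (hp : 1 < p)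
    {c b : ℝ} (hc0 : 0 ≤ c) (hc : u' c = 0) (hpos : ∀ r ∈ Ico c b, 0 < u r)
    (hE : ∀ r ∈ Ico c b, 0 ≤ energy p u u' r) : ∀ r ∈ Icc c b, u' r ≤ 0 := by
  refine fun r hr => image_le_of_deriv_right_lt_deriv_boundary' (f' := u'') (B := fun _ => 0)
    (B' := fun _ => 0) (hu.continuousOn'.mono fun x hx => hc0.trans hx.1)
    (fun x hx => (hu.hasDeriv2 x (hc0.trans hx.1)).mono (Ici_subset_Ici.2 (hc0.trans hx.1)))
    hc.le continuousOn_const (fun x _ => hasDerivWithinAt_const _ _ _) (fun x hx h => ?_) hr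
  exact hu.secondDeriv_neg_of_critical hn hp (hc0.trans hx.1) (hpos x hx) (hE x hx) h

lemma antitoneOn (hu : IsSolution n p α u u' u'') {c b : ℝ} (hc0 : 0 ≤ c)
    (hd : ∀ r ∈ Icc c b, u' r ≤ 0) : AntitoneOn u (Icc c b) := by
  refine antitoneOn_of_hasDerivWithinAt_nonpos (f' := u') (convex_Icc c b)
    (hu.continuousOn.mono fun x hx => hc0.trans hx.1) (fun r hr => ?_)
    fun r hr => hd r (interior_subset hr)
  rw [interior_Icc] at hr
  exact (hu.hasDerivAt (hc0.trans_lt hr.1)).hasDerivWithinAt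

lemma continuousOn_pohozaev (hu : IsSolution n p α u u' u'') (hp : 1 < p) :
    ContinuousOn (pohozaev n p u u') (Ici 0) :=
  (continuousOn_id.pow _).mul ((continuousOn_id.mul (hu.continuousOn_energy hp)).add
    (continuousOn_const.mul (hu.continuousOn.mul hu.continuousOn')))

lemma hasDerivAt_pohozaev (hu : IsSolution n p α u u' u'') (hn : 3 ≤ n) (hp : 1 < p) {r : ℝ}
    (hr : 0 < r) (hpos : 0 ≤ u r) :
    HasDerivAt (pohozaev n p u u') (r ^ (n - 1) * (u r ^ 2 *
      (((n : ℝ) / (p + 1) - ((n : ℝ) - 2) / 2) * u r ^ (p - 1) - 1))) r := by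
  have h1 := (hasDerivAt_pow (n - 1) r).mul
    (((hasDerivAt_id r).mul (hu.hasDerivAt_energy hp hr)).add
      (((hu.hasDerivAt hr).mul (hu.hasDerivAt' hr)).const_mul (((n : ℝ) - 2) / 2)))
  refine h1.congr_deriv ?_
  have hode := hu.ode r hr
  have h2 : u'' r = -(((n : ℝ) - 1) / r * u' r) - f p (u r) := by linarith
  have hp' : p + 1 ≠ 0 := by linarith
  obtain ⟨m, rfl⟩ : ∃ m, n = m + 2 := ⟨n - 2, by omega⟩
  simp only [h2, f_eq_of_nonneg p hpos, energy, F_eq_of_nonneg hp hpos, Pi.add_apply,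
    Pi.mul_apply, id, show m + 2 - 1 = m + 1 from rfl, Nat.add_sub_cancel, pow_succ r m]
  push_cast
  field_simp
  ring

/-- The Pohozaev functional is unimodal along a decreasing nonnegative piece of a solution. -/
lemma min_le_pohozaev (hu : IsSolution n p α u u' u'') (hn : 3 ≤ n) (hp : 1 < p)
    (hp2 : p < ((n : ℝ) + 2) / ((n : ℝ) - 2)) {c r s : ℝ} (hc0 : 0 ≤ c) (hcr : c ≤ r)
    (hrs : r ≤ s) (hpos : ∀ t ∈ Icc c s, 0 ≤ u t) (hd : ∀ t ∈ Icc c s, u' t ≤ 0)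
    (hP : 0 ≤ pohozaev n p u u' c) : min 0 (pohozaev n p u u' s) ≤ pohozaev n p u u' r := by
  have hn' : (3 : ℝ) ≤ n := by exact_mod_cast hn
  set κ : ℝ := (n : ℝ) / (p + 1) - ((n : ℝ) - 2) / 2 with hκ
  have hκ0 : 0 < κ := by
    rw [lt_div_iff₀ (by linarith)] at hp2
    rw [hκ, sub_pos, div_lt_div_iff₀ (by norm_num) (by linarith)]
    linarith
  have hanti := hu.antitoneOn hc0 hd
  have hX : ∀ a ∈ Icc c s, ∀ b ∈ Icc c s, a ≤ b → κ * u b ^ (p - 1) ≤ κ * u a ^ (p - 1) :=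
    fun a ha b hb hab => mul_le_mul_of_nonneg_left
      (Real.rpow_le_rpow (hpos b hb) (hanti ha hb hab) (by linarith)) hκ0.le
  have hr : r ∈ Icc c s := ⟨hcr, hrs⟩
  rcases le_total 1 (κ * u r ^ (p - 1)) with h | h
  · have hmono : MonotoneOn (pohozaev n p u u') (Icc c r) := by
      refine monotoneOn_of_hasDerivWithinAt_nonneg (convex_Icc c r)
        ((hu.continuousOn_pohozaev hp).mono fun x hx => hc0.trans hx.1)
        (f' := fun t => t ^ (n - 1) * (u t ^ 2 * (κ * u t ^ (p - 1) - 1)))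
        (fun t ht => ?_) fun t ht => ?_ <;> rw [interior_Icc] at ht <;>
        have ht' : t ∈ Icc c s := ⟨ht.1.le, ht.2.le.trans hrs⟩
      · exact (hu.hasDerivAt_pohozaev hn hp (hc0.trans_lt ht.1) (hpos t ht')).hasDerivWithinAt
      · exact mul_nonneg (pow_nonneg (hc0.trans ht.1.le) _)
          (mul_nonneg (sq_nonneg _) (by linarith [hX t ht' r hr ht.2.le]))
    exact (min_le_left _ _).trans (hP.trans (hmono ⟨le_rfl, hcr⟩ ⟨hcr, le_rfl⟩ hcr))
  · have hmono : AntitoneOn (pohozaev n p u u') (Icc r s) := by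
      refine antitoneOn_of_hasDerivWithinAt_nonpos (convex_Icc r s)
        ((hu.continuousOn_pohozaev hp).mono fun x hx => (hc0.trans hcr).trans hx.1)
        (f' := fun t => t ^ (n - 1) * (u t ^ 2 * (κ * u t ^ (p - 1) - 1)))
        (fun t ht => ?_) fun t ht => ?_ <;> rw [interior_Icc] at ht <;>
        have ht' : t ∈ Icc c s := ⟨hcr.trans ht.1.le, ht.2.le⟩
      · exact (hu.hasDerivAt_pohozaev hn hp ((hc0.trans hcr).trans_lt ht.1)
          (hpos t ht')).hasDerivWithinAt
      · exact mul_nonpos_of_nonneg_of_nonpos (pow_nonneg ((hc0.trans hcr).trans ht.1.le) _)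
          (mul_nonpos_of_nonneg_of_nonpos (sq_nonneg _) (by linarith [hX r hr t ht' ht.1.le]))
    exact (min_le_right _ _).trans (hmono ⟨le_rfl, hrs⟩ ⟨hrs, le_rfl⟩ hrs)

lemma pohozaev_nonneg_of_critical {c : ℝ} (hc0 : 0 ≤ c) (hc : u' c = 0)
    (hE : 0 ≤ energy p u u' c) : 0 ≤ pohozaev n p u u' c := by
  rw [pohozaev, hc, mul_zero, mul_zero, add_zero]
  positivity

/-- Where the Pohozaev functional is nonnegative, `-r u' / u` is strictly increasing. -/
lemma strictMonoOn_logDeriv (hu : IsSolution n p α u u' u'') (hp : 1 < p) {c b : ℝ}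
    (hc0 : 0 ≤ c) (hpos : ∀ r ∈ Icc c b, 0 < u r)
    (hP : ∀ r ∈ Ioc c b, 0 ≤ pohozaev n p u u' r) :
    StrictMonoOn (fun r => -(r * u' r) / u r) (Icc c b) := by
  have hsub : Icc c b ⊆ Ici 0 := fun x hx => hc0.trans hx.1
  have hder : ∀ r ∈ Ioo c b, HasDerivAt (fun r => -(r * u' r) / u r)
      ((-(1 * u' r + r * u'' r) * u r - -(r * u' r) * u' r) / u r ^ 2) r := fun r hr =>
    ((((hasDerivAt_id r).mul (hu.hasDerivAt' (hc0.trans_lt hr.1))).neg).div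
      (hu.hasDerivAt (hc0.trans_lt hr.1)) (hpos r (Ioo_subset_Icc_self hr)).ne')
  refine strictMonoOn_of_hasDerivWithinAt_pos (convex_Icc c b)
    (((continuousOn_id.mul (hu.continuousOn'.mono hsub)).neg).div (hu.continuousOn.mono hsub)
      fun r hr => (hpos r hr).ne')
    (fun r hr => (hder r (by rwa [interior_Icc] at hr)).hasDerivWithinAt) fun r hr => ?_
  rw [interior_Icc] at hr
  have hr0 : 0 < r := hc0.trans_lt hr.1
  have hur := hpos r (Ioo_subset_Icc_self hr)
  have h1 := hP r (Ioo_subset_Ioc_self hr)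
  rw [pohozaev, mul_nonneg_iff_of_pos_left (by positivity), energy,
    F_eq_of_nonneg hp hur.le] at h1
  have h2 := hu.mul_ode hr0
  rw [f_eq_of_nonneg p hur.le] at h2
  have hX : 0 < u r ^ (p - 1) := Real.rpow_pos_of_pos hur _
  refine div_pos ?_ (by positivity)
  have h3 : 0 < r * u r ^ 2 * (u r ^ (p - 1) * (1 - 2 / (p + 1))) := by
    have : 2 / (p + 1) < 1 := by rw [div_lt_one (by linarith)]; linarith
    have : 0 < 1 - 2 / (p + 1) := by linarith
    positivity
  have h4 : r * u'' r = -(((n : ℝ) - 1) * u' r) - r * (u r * (u r ^ (p - 1) - 1)) := by linarith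
  rw [h4]
  have h5 : (2 : ℝ) / (p + 1) = 2 * (1 / (p + 1)) := by ring
  rw [div_eq_mul_one_div (u r ^ (p - 1))] at h1
  rw [h5] at h3
  nlinarith

lemma secondDeriv_pos_of_le_one (hu : IsSolution n p α u u' u'') (hn : 3 ≤ n) (hp : 1 < p)
    {r : ℝ} (hr : 0 < r) (hpos : 0 < u r) (hE : 0 ≤ energy p u u' r) (hd : u' r ≤ 0)
    (h1 : u r ≤ 1) : 0 < u'' r := by
  have hn' : (3 : ℝ) ≤ n := by exact_mod_cast hn
  have hd' : u' r < 0 := hd.lt_of_ne fun h => absurd (one_lt_of_critical hp hpos hE h) h1.not_gt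
  have hf := f_nonpos hp hpos.le h1
  have : ((n : ℝ) - 1) / r * u' r < 0 :=
    mul_neg_of_pos_of_neg (div_pos (by linarith) hr) hd'
  linarith [hu.ode r hr]

/-- After a critical point, once a positive solution piece is convex it is strictly convex
from then on. -/
lemma secondDeriv_pos_of_nonneg (hu : IsSolution n p α u u' u'') (hn : 3 ≤ n) (hp : 1 < p)
    {c r₁ r₂ : ℝ} (hc0 : 0 ≤ c) (hc : u' c = 0) (hcr : c < r₁) (hrr : r₁ < r₂)
    (hpos : ∀ r ∈ Icc c r₂, 0 < u r) (hE : ∀ r ∈ Icc c r₂, 0 ≤ energy p u u' r)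
    (hP : ∀ r ∈ Ioc c r₂, 0 ≤ pohozaev n p u u' r) (h : 0 ≤ u'' r₁) : 0 < u'' r₂ := by
  have hd := hu.deriv_nonpos hn hp hc0 hc (fun r hr => hpos r (Ico_subset_Icc_self hr))
    (fun r hr => hE r (Ico_subset_Icc_self hr))
  have hanti := hu.antitoneOn hc0 hd
  have hr2 : r₂ ∈ Icc c r₂ := ⟨(hcr.trans hrr).le, le_rfl⟩
  have hr1 : r₁ ∈ Icc c r₂ := ⟨hcr.le, hrr.le⟩
  have hcm : c ∈ Icc c r₂ := ⟨le_rfl, (hcr.trans hrr).le⟩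
  have hr10 : 0 < r₁ := hc0.trans_lt hcr
  have hr20 : 0 < r₂ := hr10.trans hrr
  rcases le_or_gt (u r₂) 1 with hle | hgt
  · exact hu.secondDeriv_pos_of_le_one hn hp hr20 (hpos _ hr2) (hE _ hr2) (hd _ hr2) hle
  have hu1 : ∀ r ∈ Icc c r₂, 1 < u r := fun r hr => hgt.trans_le (hanti hr hr2 hr.2)
  have hX1 : ∀ r ∈ Icc c r₂, 1 < u r ^ (p - 1) := fun r hr =>
    Real.one_lt_rpow (hu1 r hr) (by linarith)
  have hpX : ∀ r ∈ Icc c r₂, 0 < p * u r ^ (p - 1) - 1 := fun r hr => by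
    nlinarith [hX1 r hr]
  set A : ℝ → ℝ := fun r =>
    (u r ^ (p - 1) - 1) / (p * u r ^ (p - 1) - 1) - -(r * u' r) / u r with hA
  have hAanti : StrictAntiOn A (Icc c r₂) := by
    intro a ha b hb hab
    have h1 := hu.strictMonoOn_logDeriv hp hc0 hpos hP ha hb hab
    have h2 : (u b ^ (p - 1) - 1) / (p * u b ^ (p - 1) - 1) ≤
        (u a ^ (p - 1) - 1) / (p * u a ^ (p - 1) - 1) := by
      have h3 : u b ^ (p - 1) ≤ u a ^ (p - 1) :=
        Real.rpow_le_rpow (hpos b hb).le (hanti ha hb hab.le) (by linarith)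
      rw [div_le_div_iff₀ (hpX b hb) (hpX a ha)]
      nlinarith
    simp only [hA]
    simp only at h1
    linarith
  set K : ℝ → ℝ := fun r => r ^ (n - 1) * (r * f p (u r) + ((n : ℝ) - 1) * u' r) with hK
  have hKu : ∀ r, 0 < r → K r = -(r ^ (n - 1) * r * u'' r) := fun r hr => by
    have := hu.mul_ode hr
    have h2 : r * f p (u r) + ((n : ℝ) - 1) * u' r = -(r * u'' r) := by linarith
    simp only [hK, h2]; ring
  have hKcont : ContinuousOn K (Icc c r₂) := by
    have hsub : Icc c r₂ ⊆ Ici 0 := fun x hx => hc0.trans hx.1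
    exact (continuousOn_id.pow _).mul ((continuousOn_id.mul
      ((continuous_f hp).comp_continuousOn (hu.continuousOn.mono hsub))).add
      (continuousOn_const.mul (hu.continuousOn'.mono hsub)))
  have hKder : ∀ r ∈ Ioo c r₂, HasDerivAt K
      (r ^ (n - 1) * (u r * (p * u r ^ (p - 1) - 1)) * A r) r := by
    intro r hr
    have hr' := Ioo_subset_Icc_self hr
    have hr0 : 0 < r := hc0.trans_lt hr.1
    have hur := hpos r hr'
    have h1 := (hasDerivAt_pow (n - 1) r).mul
      (((hasDerivAt_id r).mul ((hasDerivAt_f (p := p) hur).comp r (hu.hasDerivAt hr0))).add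
        ((hu.hasDerivAt' hr0).const_mul ((n : ℝ) - 1)))
    refine h1.congr_deriv ?_
    have hode := hu.ode r hr0
    have h2 : u'' r = -(((n : ℝ) - 1) / r * u' r) - f p (u r) := by linarith
    have h3 := (hpX r hr').ne'
    have h4 : u r * (p * u r ^ (p - 1) - 1) * A r =
        u r * (u r ^ (p - 1) - 1) + r * u' r * (p * u r ^ (p - 1) - 1) := by
      simp only [hA]; field_simp; ring
    rw [mul_assoc _ _ (A r), h4]
    obtain ⟨m, rfl⟩ : ∃ m, n = m + 2 := ⟨n - 2, by omega⟩
    simp only [h2, f_eq_of_nonneg p hur.le, Pi.add_apply, Function.comp_apply,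
      Pi.mul_apply, id, show m + 2 - 1 = m + 1 from rfl, Nat.add_sub_cancel, pow_succ r m]
    push_cast
    field_simp
    ring
  have hcoef : ∀ r ∈ Ioo c r₂, 0 < r ^ (n - 1) * (u r * (p * u r ^ (p - 1) - 1)) :=
    fun r hr => mul_pos (pow_pos (hc0.trans_lt hr.1) _)
      (mul_pos (hpos r (Ioo_subset_Icc_self hr)) (hpX r (Ioo_subset_Icc_self hr)))
  have hKc : 0 ≤ K c := by
    simp only [hK, hc, mul_zero, add_zero]
    exact mul_nonneg (pow_nonneg hc0 _) (mul_nonneg hc0 (f_pos hp (hu1 c hcm)).le)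
  have hK1 : K r₁ ≤ 0 := by
    rw [hKu r₁ hr10, neg_nonpos]; positivity
  have hA1 : A r₁ < 0 := by
    by_contra! hA1
    have hmono : StrictMonoOn K (Icc c r₁) := by
      refine strictMonoOn_of_hasDerivWithinAt_pos (convex_Icc c r₁)
        (hKcont.mono (Icc_subset_Icc_right hrr.le))
        (f' := fun r => r ^ (n - 1) * (u r * (p * u r ^ (p - 1) - 1)) * A r)
        (fun r hr => ?_) fun r hr => ?_ <;> rw [interior_Icc] at hr <;>
        have hr' : r ∈ Ioo c r₂ := ⟨hr.1, hr.2.trans hrr⟩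
      · exact (hKder r hr').hasDerivWithinAt
      · exact mul_pos (hcoef r hr') (hA1.trans_lt (hAanti (Ioo_subset_Icc_self hr') hr1 hr.2))
    linarith [hmono ⟨le_rfl, hcr.le⟩ ⟨hcr.le, le_rfl⟩ hcr]
  have hmono : StrictAntiOn K (Icc r₁ r₂) := by
    refine strictAntiOn_of_hasDerivWithinAt_neg (convex_Icc r₁ r₂)
      (hKcont.mono (Icc_subset_Icc_left hcr.le))
      (f' := fun r => r ^ (n - 1) * (u r * (p * u r ^ (p - 1) - 1)) * A r)
      (fun r hr => ?_) fun r hr => ?_ <;> rw [interior_Icc] at hr <;>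
      have hr' : r ∈ Ioo c r₂ := ⟨hcr.trans hr.1, hr.2⟩
    · exact (hKder r hr').hasDerivWithinAt
    · exact mul_neg_of_pos_of_neg (hcoef r hr')
        ((hAanti hr1 (Ioo_subset_Icc_self hr') hr.1).trans hA1)
  have hK2 : K r₂ < 0 := (hmono ⟨le_rfl, hrr.le⟩ ⟨hrr.le, le_rfl⟩ hrr).trans_le hK1
  rw [hKu r₂ hr20, neg_lt_zero] at hK2
  exact (mul_pos_iff_of_pos_left (by positivity)).1 hK2

lemma exists_secondDeriv_eq_zero (hu : IsSolution n p α u u' u'') (hn : 3 ≤ n) (hp : 1 < p)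
    {c b : ℝ} (hc0 : 0 ≤ c) (hc : u' c = 0) (hcb : c < b)
    (hpos : ∀ r ∈ Icc c b, 0 < u r) (hE : ∀ r ∈ Icc c b, 0 ≤ energy p u u' r)
    (hb : u b ≤ 1) : ∃ r ∈ Ioo c b, u'' r = 0 := by
  have hbm : b ∈ Icc c b := ⟨hcb.le, le_rfl⟩
  have hcm : c ∈ Icc c b := ⟨le_rfl, hcb.le⟩
  have hd := hu.deriv_nonpos hn hp hc0 hc (fun r hr => hpos r (Ico_subset_Icc_self hr))
    (fun r hr => hE r (Ico_subset_Icc_self hr))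
  exact intermediate_value_Ioo hcb.le (hu.cont2.mono fun x hx => hc0.trans hx.1)
    ⟨hu.secondDeriv_neg_of_critical hn hp hc0 (hpos c hcm) (hE c hcm) hc,
      hu.secondDeriv_pos_of_le_one hn hp (hc0.trans_lt hcb) (hpos b hbm) (hE b hbm) (hd b hbm) hb⟩

/-- A positive arc from a critical point down to a zero has exactly one inflection point. -/
lemma existsUnique_inflection_of_pos (hu : IsSolution n p α u u' u'') (hn : 3 ≤ n) (hp : 1 < p)
    (hp2 : p < ((n : ℝ) + 2) / ((n : ℝ) - 2)) {c z : ℝ} (hc0 : 0 ≤ c) (hc : u' c = 0)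
    (hcz : c < z) (hz : u z = 0) (hpos : ∀ r ∈ Ioo c z, 0 < u r) :
    ∃! r : ℝ, c < r ∧ r < z ∧ u'' r = 0 := by
  have hn' : (3 : ℝ) ≤ n := by exact_mod_cast hn
  have hz0 : 0 < z := hc0.trans_lt hcz
  have hEanti := hu.antitoneOn_energy hn hp
  have hEz : 0 ≤ energy p u u' z := by
    rw [energy, hz, F_zero hp]; positivity
  have hE : ∀ r ∈ Icc c z, 0 ≤ energy p u u' r := fun r hr =>
    hEz.trans (hEanti (hc0.trans hr.1) hz0.le hr.2)
  have hsub : Icc c z ⊆ Ici 0 := fun x hx => hc0.trans hx.1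
  have hnonneg : ∀ r ∈ Icc c z, 0 ≤ u r := by
    have hcl : closure (Ioo c z) = Icc c z := closure_Ioo hcz.ne
    intro r hr
    refine le_on_closure (f := fun _ => (0 : ℝ)) (fun x hx => (hpos x hx).le) continuousOn_const
      (by rw [hcl]; exact hu.continuousOn.mono hsub) (by rwa [hcl])
  have huc : 0 < u c := by
    refine (hnonneg c ⟨le_rfl, hcz.le⟩).lt_of_ne' fun huc => ?_
    have hEc : energy p u u' c = 0 := by simp [energy, huc, hc, F_zero hp]
    have hE0 : ∀ r ∈ Icc c z, energy p u u' r = 0 := fun r hr =>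
      le_antisymm (hEc ▸ hEanti hc0 (hc0.trans hr.1) hr.1) (hE r hr)
    have hd0 : ∀ r ∈ Ioo c z, u' r = 0 := by
      intro r hr
      have hr0 : 0 < r := hc0.trans_lt hr.1
      have h1 : HasDerivAt (energy p u u') 0 r :=
        (hasDerivAt_const r (0 : ℝ)).congr_of_eventuallyEq (by
          filter_upwards [Ioo_mem_nhds hr.1 hr.2] with x hx
          exact hE0 x (Ioo_subset_Icc_self hx))
      have h2 := h1.unique (hu.hasDerivAt_energy hp hr0)
      have h3 : 0 < ((n : ℝ) - 1) / r := div_pos (by linarith) hr0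
      have h4 : ((n : ℝ) - 1) / r * u' r ^ 2 = 0 := by linarith
      simpa [h3.ne'] using h4
    have hanti := antitoneOn_of_hasDerivWithinAt_nonpos (f' := u') (convex_Icc c z)
      (hu.continuousOn.mono hsub)
      (fun r hr => (hu.hasDerivAt (hc0.trans_lt (by
        rw [interior_Icc] at hr; exact hr.1))).hasDerivWithinAt)
      (fun r hr => (hd0 r (by rwa [interior_Icc] at hr)).le)
    obtain ⟨x, hx⟩ := nonempty_Ioo.2 hcz
    have := hanti ⟨le_rfl, hcz.le⟩ (Ioo_subset_Icc_self hx) hx.1.le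
    linarith [hpos x hx]
  have hpos' : ∀ r ∈ Ico c z, 0 < u r := by
    intro r hr
    rcases hr.1.eq_or_lt with rfl | h
    · exact huc
    · exact hpos r ⟨h, hr.2⟩
  have hd := hu.deriv_nonpos hn hp hc0 hc hpos' fun r hr => hE r (Ico_subset_Icc_self hr)
  have hPz : 0 ≤ pohozaev n p u u' z := by
    rw [pohozaev, hz, zero_mul, mul_zero, add_zero]; positivity
  have hP : ∀ r ∈ Icc c z, 0 ≤ pohozaev n p u u' r := fun r hr => by
    have h := hu.min_le_pohozaev hn hp hp2 hc0 hr.1 hr.2 hnonneg hd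
      (pohozaev_nonneg_of_critical hc0 hc (hE c ⟨le_rfl, hcz.le⟩))
    rwa [min_eq_left hPz] at h
  obtain ⟨b, hb, hub⟩ : ∃ b ∈ Ioo c z, u b ≤ 1 := by
    have h1 : ∀ᶠ x in nhdsWithin z (Iio z), u x < 1 :=
      (((hu.hasDerivAt hz0).continuousAt.eventually_lt_const (by rw [hz]; norm_num)).filter_mono
        nhdsWithin_le_nhds)
    obtain ⟨b, h2, h3⟩ := (h1.and (Ioo_mem_nhdsLT hcz)).exists
    exact ⟨b, h3, h2.le⟩
  obtain ⟨r, hr, hr0⟩ := hu.exists_secondDeriv_eq_zero hn hp hc0 hc hb.1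
    (fun r hr => hpos' r ⟨hr.1, hr.2.trans_lt hb.2⟩) (fun r hr => hE r ⟨hr.1, hr.2.trans hb.2.le⟩)
    hub
  have hlt : ∀ x y, c < x → x < y → y < z → u'' x = 0 → u'' y ≠ 0 :=
    fun x y hx hxy hy h0 => (hu.secondDeriv_pos_of_nonneg hn hp hc0 hc hx hxy
      (fun t ht => hpos' t ⟨ht.1, ht.2.trans_lt hy⟩) (fun t ht => hE t ⟨ht.1, ht.2.trans hy.le⟩)
      (fun t ht => hP t ⟨ht.1.le, ht.2.trans hy.le⟩) h0.ge).ne'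
  refine ⟨r, ⟨hr.1, hr.2.trans hb.2, hr0⟩, fun y hy => ?_⟩
  rcases lt_trichotomy y r with h | h | h
  · exact absurd hr0 (hlt y r hy.1 h (hr.2.trans hb.2) hy.2.2)
  · exact h
  · exact absurd hy.2.2 (hlt r y hr.1 h hy.2.1 hr0)

/-- Nonnegative energy forces exponential decay of a positive decreasing solution. -/
lemma tendsto_pow_mul_of_decaying (hu : IsSolution n p α u u' u'') (hp : 1 < p)
    (hdec : Decaying u u') (hpos : ∀ r, 0 ≤ r → 0 < u r)
    (hE : ∀ r, 0 ≤ r → 0 ≤ energy p u u' r) (hd : ∀ r, 0 ≤ r → u' r ≤ 0) (k : ℕ) :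
    Tendsto (fun r => r ^ k * u r) atTop (nhds 0) := by
  have hX : Tendsto (fun r => u r ^ (p - 1)) atTop (nhds 0) := by
    have h := hdec.1.rpow_const (p := p - 1) (Or.inr (by linarith))
    rwa [Real.zero_rpow (by linarith)] at h
  obtain ⟨R, hR⟩ := eventually_atTop.1
    ((hX.eventually_lt_const (by norm_num : (0 : ℝ) < 3 / 4)).and (eventually_gt_atTop 0))
  have hR0 : 0 < R := (hR R le_rfl).2
  have hslope : ∀ r, R ≤ r → u' r ≤ -(u r / 2) := by
    intro r hr
    have hr0 : 0 ≤ r := hR0.le.trans hr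
    have h1 := hE r hr0
    rw [energy, F_eq_of_nonneg hp (hpos r hr0).le] at h1
    have h2 : u r ^ (p - 1) / (p + 1) ≤ 3 / 8 := by
      rw [div_le_iff₀ (by linarith)]
      linarith [(hR r hr).1]
    have h3 : (u r / 2) ^ 2 ≤ (-u' r) ^ 2 := by
      nlinarith [mul_le_mul_of_nonneg_left h2 (sq_nonneg (u r))]
    have := abs_le_of_sq_le_sq' h3 (by linarith [hd r hr0])
    linarith [this.2]
  have hanti : AntitoneOn (fun r => u r * Real.exp (r / 2)) (Ici R) := by
    refine antitoneOn_of_hasDerivWithinAt_nonpos (convex_Ici R)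
      ((hu.continuousOn.mono (Ici_subset_Ici.2 hR0.le)).mul (by fun_prop))
      (f' := fun r => u' r * Real.exp (r / 2) + u r * (Real.exp (r / 2) * (1 / 2)))
      (fun r hr => ?_) fun r hr => ?_ <;> rw [interior_Ici] at hr
    · exact ((hu.hasDerivAt (hR0.trans hr)).mul
        (((hasDerivAt_id r).div_const 2).exp)).hasDerivWithinAt
    · have := hslope r (le_of_lt hr)
      nlinarith [Real.exp_pos (r / 2)]
  have hlim : Tendsto (fun r : ℝ => u R * Real.exp (R / 2) *
      (r ^ (k : ℝ) * Real.exp (-(1 / 2) * r))) atTop (nhds 0) := by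
    simpa using (tendsto_rpow_mul_exp_neg_mul_atTop_nhds_zero (k : ℝ) (1 / 2)
      (by norm_num)).const_mul (u R * Real.exp (R / 2))
  refine squeeze_zero' ?_ ?_ hlim
  · filter_upwards [eventually_ge_atTop 0] with r hr
    exact mul_nonneg (pow_nonneg hr k) (hpos r hr).le
  · filter_upwards [eventually_ge_atTop R] with r hr
    have h1 : u r * Real.exp (r / 2) ≤ u R * Real.exp (R / 2) := hanti self_mem_Ici hr hr
    have h2 : u r ≤ u R * Real.exp (R / 2) * Real.exp (-(1 / 2) * r) := by
      have h3 := mul_le_mul_of_nonneg_right h1 (Real.exp_pos (-(1 / 2) * r)).le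
      have h4 : Real.exp (r / 2) * Real.exp (-(1 / 2) * r) = 1 := by
        rw [← Real.exp_add, show r / 2 + -(1 / 2) * r = 0 by ring, Real.exp_zero]
      rwa [mul_assoc (u r), h4, mul_one] at h3
    have h5 := mul_le_mul_of_nonneg_left h2 (pow_nonneg (hR0.le.trans hr) k)
    rw [Real.rpow_natCast]
    linarith

lemma exists_inflection_of_groundState (hu : IsSolution n p α u u' u'') (hn : 3 ≤ n)
    (hp : 1 < p) (hp2 : p < ((n : ℝ) + 2) / ((n : ℝ) - 2)) (hdec : Decaying u u')
    (hpos : ∀ r, 0 ≤ r → 0 < u r) :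
    ∃ rs : ℝ, 0 < rs ∧ u'' rs = 0 ∧
      (∀ r : ℝ, 0 < r → r < rs → u'' r < 0) ∧ (∀ r : ℝ, rs < r → 0 < u'' r) := by
  have hE : ∀ r, 0 ≤ r → 0 ≤ energy p u u' r := by
    have hlim : Tendsto (energy p u u') atTop (nhds 0) := by
      have h := ((hdec.2.pow 2).div_const 2).add
        (((hasDerivAt_F hp 0).continuousAt.tendsto).comp hdec.1)
      change Tendsto (fun r => u' r ^ 2 / 2 + F p (u r)) atTop (nhds 0)
      simpa [F_zero hp] using h
    intro r hr
    refine le_of_tendsto hlim ?_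
    filter_upwards [eventually_ge_atTop r] with s hs
    exact hu.antitoneOn_energy hn hp hr (hr.trans hs) hs
  have hd : ∀ r, 0 ≤ r → u' r ≤ 0 := fun r hr =>
    hu.deriv_nonpos hn hp le_rfl hu.initDeriv (fun s hs => hpos s hs.1) (fun s hs => hE s hs.1)
      r ⟨hr, le_rfl⟩
  have hP : ∀ r, 0 ≤ r → 0 ≤ pohozaev n p u u' r := by
    intro r hr
    have h1 : Tendsto (fun s => min 0 (((n : ℝ) - 2) / 2 * (s ^ (n - 1) * u s * u' s)))
        atTop (nhds 0) := by
      have h := (tendsto_const_nhds (x := (0 : ℝ))).min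
        (((hu.tendsto_pow_mul_of_decaying hp hdec hpos hE hd (n - 1)).mul hdec.2).const_mul
          (((n : ℝ) - 2) / 2))
      simpa using h
    refine le_of_tendsto h1 ?_
    filter_upwards [eventually_ge_atTop r] with s hs
    refine le_trans (min_le_min_left 0 ?_) (hu.min_le_pohozaev hn hp hp2 le_rfl hr hs
      (fun t ht => (hpos t ht.1).le) (fun t ht => hd t ht.1)
      (pohozaev_nonneg_of_critical le_rfl hu.initDeriv (hE 0 le_rfl)))
    have hs0 : 0 ≤ s := hr.trans hs
    have h2 : 0 ≤ s ^ (n - 1) * (s * energy p u u' s) :=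
      mul_nonneg (pow_nonneg hs0 _) (mul_nonneg hs0 (hE s hs0))
    rw [pohozaev, mul_add]
    linarith
  obtain ⟨b, hb0, hb⟩ := ((eventually_gt_atTop (0 : ℝ)).and
    (hdec.1.eventually_lt_const one_pos)).exists
  obtain ⟨rs, hrs, hrs0⟩ := hu.exists_secondDeriv_eq_zero hn hp le_rfl hu.initDeriv hb0
    (fun r hr => hpos r hr.1) (fun r hr => hE r hr.1) hb.le
  have hlt : ∀ x y, 0 < x → x < y → 0 ≤ u'' x → 0 < u'' y := fun x y hx hxy h0 =>
    hu.secondDeriv_pos_of_nonneg hn hp le_rfl hu.initDeriv hx hxy (fun t ht => hpos t ht.1)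
      (fun t ht => hE t ht.1) (fun t ht => hP t ht.1.le) h0
  refine ⟨rs, hrs.1, hrs0, fun r hr hrr => ?_, fun r hr => hlt rs r hrs.1 hr hrs0.ge⟩
  by_contra! h
  exact (hlt r rs hr hrr h).ne' hrs0

/-- An arc from a critical point to the next zero has exactly one inflection point. -/
lemma existsUnique_inflection (hu : IsSolution n p α u u' u'') (hn : 3 ≤ n) (hp : 1 < p)
    (hp2 : p < ((n : ℝ) + 2) / ((n : ℝ) - 2)) {c z : ℝ} (hc0 : 0 ≤ c) (hc : u' c = 0)
    (hcz : c < z) (hz : u z = 0) (hne : ∀ r ∈ Ioo c z, u r ≠ 0) :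
    ∃! r : ℝ, c < r ∧ r < z ∧ u'' r = 0 := by
  have hcont : ContinuousOn u (Ioo c z) := hu.continuousOn.mono fun x hx => hc0.trans hx.1.le
  by_cases h : ∀ r ∈ Ioo c z, 0 < u r
  · exact hu.existsUnique_inflection_of_pos hn hp hp2 hc0 hc hcz hz h
  · push Not at h
    obtain ⟨a, ha, hua⟩ := h
    have hneg : ∀ r ∈ Ioo c z, 0 < -u r := by
      intro r hr
      by_contra! hur
      obtain ⟨x, hx, hx0⟩ := isPreconnected_Ioo.intermediate_value ha hr hcont
        ⟨hua, neg_nonpos.1 hur⟩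
      exact hne x hx hx0
    simpa using hu.neg.existsUnique_inflection_of_pos hn hp hp2 hc0 (by simp [hc]) hcz
      (by simp [hz]) hneg

end IsSolution

/-- a ground state changes concavity at a unique inflection point; a nodal
solution has exactly one zero of `u''` between each critical point (or `0`) and the next
zero of `u`. -/
theorem statement15 (n : ℕ) (hn : 3 ≤ n) (p : ℝ) (hp1 : 1 < p)
    (hp2 : p < ((n : ℝ) + 2) / ((n : ℝ) - 2))
    (α : ℝ) (hα : 0 < α)
    (u u' u'' : ℝ → ℝ) (hu : IsSolution n p α u u' u'') :
    ((Decaying u u' ∧ ∀ r : ℝ, 0 ≤ r → 0 < u r) →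
      ∃ rs : ℝ, 0 < rs ∧ u'' rs = 0 ∧
        (∀ r : ℝ, 0 < r → r < rs → u'' r < 0) ∧ (∀ r : ℝ, rs < r → 0 < u'' r)) ∧
    (ChangesSign u →
      ∀ c zz : ℝ, 0 ≤ c → (c = 0 ∨ u' c = 0) → c < zz → u zz = 0 →
        (∀ r : ℝ, c < r → r < zz → u r ≠ 0) →
        ∃! r : ℝ, c < r ∧ r < zz ∧ u'' r = 0) := by
  refine ⟨fun h => hu.exists_inflection_of_groundState hn hp1 hp2 h.1 h.2, ?_⟩
  intro _ c zz hc0 hc hcz hz hne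
  have hc' : u' c = 0 := hc.elim (fun h => h ▸ hu.initDeriv) id
  exact hu.existsUnique_inflection hn hp1 hp2 hc0 hc' hcz hz fun r hr => hne r hr.1 hr.2
end

section
/- Let u be a ground state or a solution of the IVP that changes sign, let v be the variation associated with u, and let r₁ > 0 be such that u(r) > 1 for all r ∈ [0, r₁) and u(r₁) = 1. Then v changes sign in (0, r₁): there exists τ ∈ (0, r₁) with v(τ) = 0. -/
open Real Filter Set

/-- Strict convexity of the nonlinearity: `f(s) < f'(s) (s - 1)` for `s > 1`. -/
theorem f_lt_fder_mul_sub_one {p s : ℝ} (hp : 1 < p) (hs : 1 < s) :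
    f p s < fder p s * (s - 1) := by
  have hs0 : 0 < s := by linarith
  have hinv : 0 < s⁻¹ := inv_pos.mpr hs0
  have bernoulli : 1 + p * (s⁻¹ - 1) < (1 + (s⁻¹ - 1)) ^ p :=
    one_add_mul_self_lt_rpow_one_add (by linarith)
      (sub_ne_zero.mpr (inv_lt_one_of_one_lt₀ hs).ne) hp
  rw [add_sub_cancel, Real.inv_rpow hs0.le] at bernoulli
  have hpow : s ^ p = s ^ (p - 1) * s := by
    rw [← Real.rpow_add_one hs0.ne', sub_add_cancel]
  have hpos : 0 < s ^ p := Real.rpow_pos_of_pos hs0 p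
  have key := mul_lt_mul_of_pos_right bernoulli hpos
  rw [inv_mul_cancel₀ hpos.ne', hpow] at key
  have hcancel : s⁻¹ * s = 1 := inv_mul_cancel₀ hs0.ne'
  have expand : (1 + p * (s⁻¹ - 1)) * (s ^ (p - 1) * s)
      = s ^ (p - 1) * s + p * s ^ (p - 1) * (s⁻¹ * s) - p * s ^ (p - 1) * s := by ring
  rw [expand, hcancel] at key
  simp only [f, fder, abs_of_pos hs0]
  linarith

/-- A function that is at least its value at `b` on a left neighbourhood of `b` has
nonpositive derivative there. -/
theorem HasDerivAt.nonpos_of_forall_lt_le {g : ℝ → ℝ} {g' a b : ℝ} (hab : a < b)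
    (hg : HasDerivAt g g' b) (h : ∀ x, a < x → x < b → g b ≤ g x) : g' ≤ 0 := by
  have hslope := (hasDerivWithinAt_iff_tendsto_slope' (s := Iio b) (lt_irrefl b)).mp
    hg.hasDerivWithinAt
  refine le_of_tendsto hslope ?_
  filter_upwards [Ioo_mem_nhdsLT hab] with x hx
  rw [slope_def_field]
  exact div_nonpos_of_nonneg_of_nonpos (by linarith [h x hx.1 hx.2]) (by linarith [hx.2])

/-- Derivative of the weighted Wronskian of `u - 1` and `v`. -/
theorem hasDerivAt_weighted_wronskian {n : ℕ} (hn : 1 ≤ n) {p α : ℝ}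
    {u u' u'' v v' v'' : ℝ → ℝ} (hu : IsSolution n p α u u' u'')
    (hv : IsVariation n p u v v' v'') {r : ℝ} (hr : 0 < r) :
    HasDerivAt (fun r => r ^ (n - 1) * (u' r * v r - (u r - 1) * v' r))
      (r ^ (n - 1) * ((fder p (u r) * (u r - 1) - f p (u r)) * v r)) r := by
  have hmem : Ici (0 : ℝ) ∈ nhds r := Ici_mem_nhds hr
  have du := (hu.hasDeriv1 r hr.le).hasDerivAt hmem
  have du' := (hu.hasDeriv2 r hr.le).hasDerivAt hmem
  have dv := (hv.hasDeriv1 r hr.le).hasDerivAt hmem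
  have dv' := (hv.hasDeriv2 r hr.le).hasDerivAt hmem
  refine ((hasDerivAt_pow (n - 1) r).mul
    ((du'.mul dv).sub ((du.sub_const 1).mul dv'))).congr_deriv ?_
  have hu'' : u'' r = -(((n : ℝ) - 1) / r * u' r) - f p (u r) := by linarith [hu.ode r hr]
  have hv'' : v'' r = -(((n : ℝ) - 1) / r * v' r) - fder p (u r) * v r := by
    linarith [hv.ode r hr]
  have hpow : ((n - 1 : ℕ) : ℝ) * r ^ (n - 1 - 1) = r ^ (n - 1) * (((n : ℝ) - 1) / r) := by
    obtain ⟨m, rfl⟩ := Nat.exists_eq_add_of_le' hn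
    rcases m with _ | m
    · simp
    · simp only [Nat.add_sub_cancel, pow_succ]
      push_cast
      field_simp
      ring
  simp only [Pi.mul_apply, Pi.sub_apply]
  rw [hpow, hu'', hv'']
  ring

/-- the variation `v` changes sign before `u` comes down to the level `1`. -/
theorem statement16 (n : ℕ) (hn : 3 ≤ n) (p : ℝ) (hp1 : 1 < p)
    (hp2 : p < ((n : ℝ) + 2) / ((n : ℝ) - 2))
    (α : ℝ) (hα : 0 < α)
    (u u' u'' v v' v'' : ℝ → ℝ)
    (hu : IsSolution n p α u u' u'') (hv : IsVariation n p u v v' v'')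
    (hcase : (Decaying u u' ∧ ∀ r : ℝ, 0 ≤ r → 0 < u r) ∨ ChangesSign u)
    (r₁ : ℝ) (hr₁ : 0 < r₁) (habove : ∀ r : ℝ, 0 ≤ r → r < r₁ → 1 < u r)
    (hlevel : u r₁ = 1) :
    ∃ τ : ℝ, 0 < τ ∧ τ < r₁ ∧ v τ = 0 := by
  by_contra! hzero
  have cu : ContinuousOn u (Ici 0) := fun r hr => (hu.hasDeriv1 r hr).continuousWithinAt
  have cu' : ContinuousOn u' (Ici 0) := fun r hr => (hu.hasDeriv2 r hr).continuousWithinAt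
  have cv : ContinuousOn v (Ici 0) := fun r hr => (hv.hasDeriv1 r hr).continuousWithinAt
  have cv' : ContinuousOn v' (Ici 0) := fun r hr => (hv.hasDeriv2 r hr).continuousWithinAt
  have vpos : ∀ r, 0 < r → r < r₁ → 0 < v r := by
    intro r hr hr1
    by_contra! hneg
    obtain ⟨t, ht, hvt⟩ := intermediate_value_Icc' hr.le (cv.mono Icc_subset_Ici_self)
      (show (0 : ℝ) ∈ Icc (v r) (v 0) from ⟨hneg, by rw [hv.init]; exact zero_le_one⟩)
    have ht0 : t ≠ 0 := by
      rintro rfl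
      rw [hv.init] at hvt
      exact one_ne_zero hvt
    exact hzero t (lt_of_le_of_ne ht.1 ht0.symm) (ht.2.trans_lt hr1) hvt
  have vnonneg : 0 ≤ v r₁ := by
    have hc : ContinuousAt v r₁ := cv.continuousAt (Ici_mem_nhds hr₁)
    refine ge_of_tendsto (hc.tendsto.mono_left (nhdsWithin_le_nhds (s := Iio r₁))) ?_
    filter_upwards [Ioo_mem_nhdsLT hr₁] with x hx using (vpos x hx.1 hx.2).le
  have hu'r₁ : u' r₁ ≤ 0 :=
    ((hu.hasDeriv1 r₁ hr₁.le).hasDerivAt (Ici_mem_nhds hr₁)).nonpos_of_forall_lt_le hr₁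
      fun x hx hx1 => by rw [hlevel]; exact (habove x hx.le hx1).le
  have hmono : StrictMonoOn (fun r => r ^ (n - 1) * (u' r * v r - (u r - 1) * v' r))
      (Icc 0 r₁) := by
    refine strictMonoOn_of_deriv_pos (convex_Icc 0 r₁) ?_ fun r hr => ?_
    · exact ((continuous_pow (n - 1)).continuousOn.mul ((cu'.mul cv).sub
        ((cu.sub continuousOn_const).mul cv'))).mono Icc_subset_Ici_self
    · rw [interior_Icc] at hr
      rw [(hasDerivAt_weighted_wronskian (by lia) hu hv hr.1).deriv]
      exact mul_pos (pow_pos hr.1 _) (mul_pos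
        (sub_pos.mpr (f_lt_fder_mul_sub_one hp1 (habove r hr.1.le hr.2))) (vpos r hr.1 hr.2))
  have hlt := hmono (left_mem_Icc.mpr hr₁.le) (right_mem_Icc.mpr hr₁.le) hr₁
  have hn1 : n - 1 ≠ 0 := by lia
  simp only [zero_pow hn1, zero_mul, hlevel, sub_self, sub_zero] at hlt
  exact hlt.not_ge
    (mul_nonpos_of_nonneg_of_nonpos (pow_nonneg hr₁.le _)
      (mul_nonpos_of_nonpos_of_nonneg hu'r₁ vnonneg))
end

section
/- Let u be a ground state, let v be the variation associated with u, and let r₁ > 0 be the unique point with u(r₁) = 1. Then there exists τ₁ ∈ (0, r₁) such that v(r) > 0 on [0, τ₁), v(τ₁) = 0, v(r) < 0 on (τ₁, ∞), and v(r) → −∞ as r → ∞. -/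
open Real Filter Set

theorem lt_of_hasDerivAt_pos {g g' : ℝ → ℝ} {a b : ℝ} (hab : a < b)
    (hc : ContinuousOn g (Icc a b)) (hd : ∀ x ∈ Ioo a b, HasDerivAt g (g' x) x)
    (hp : ∀ x ∈ Ioo a b, 0 < g' x) : g a < g b := by
  obtain ⟨c, hcm, hce⟩ := exists_hasDerivAt_eq_slope g g' hab hc hd
  have h1 := hp c hcm
  rw [hce] at h1
  have h2 : 0 < b - a := sub_pos.2 hab
  have h3 := (div_pos_iff_of_pos_right h2).1 h1
  linarith

theorem lt_of_hasDerivAt_neg {g g' : ℝ → ℝ} {a b : ℝ} (hab : a < b)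
    (hc : ContinuousOn g (Icc a b)) (hd : ∀ x ∈ Ioo a b, HasDerivAt g (g' x) x)
    (hp : ∀ x ∈ Ioo a b, g' x < 0) : g b < g a := by
  have := lt_of_hasDerivAt_pos (g := fun x => -g x) (g' := fun x => -g' x) hab hc.neg
    (fun x hx => (hd x hx).neg) (fun x hx => neg_pos.2 (hp x hx))
  linarith

theorem le_of_hasDerivAt_nonpos {g g' : ℝ → ℝ} {a b : ℝ} (hab : a < b)
    (hc : ContinuousOn g (Icc a b)) (hd : ∀ x ∈ Ioo a b, HasDerivAt g (g' x) x)
    (hp : ∀ x ∈ Ioo a b, g' x ≤ 0) : g b ≤ g a := by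
  obtain ⟨c, hcm, hce⟩ := exists_hasDerivAt_eq_slope g g' hab hc hd
  have h1 := hp c hcm
  rw [hce] at h1
  have h2 : 0 < b - a := sub_pos.2 hab
  by_contra! h3
  have h4 := div_pos (sub_pos.2 h3) h2
  linarith

/-- The first zero of a continuous function that is positive at `a`. -/
theorem exists_first_zero {g : ℝ → ℝ} {a b : ℝ} (hab : a ≤ b) (hc : ContinuousOn g (Icc a b))
    (ha : 0 < g a) (hb : g b ≤ 0) :
    ∃ c, a < c ∧ c ≤ b ∧ g c = 0 ∧ ∀ x, a ≤ x → x < c → 0 < g x := by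
  set S : Set ℝ := Icc a b ∩ g ⁻¹' Iic 0 with hS
  have hcl : IsClosed S := hc.preimage_isClosed_of_isClosed isClosed_Icc isClosed_Iic
  have hne : S.Nonempty := ⟨b, ⟨hab, le_rfl⟩, hb⟩
  have hbd : BddBelow S := ⟨a, fun x hx => hx.1.1⟩
  have hm : sInf S ∈ S := hcl.csInf_mem hne hbd
  obtain ⟨⟨h1, h2⟩, h3⟩ := hm
  have h3' : g (sInf S) ≤ 0 := h3
  have hlt : a < sInf S := by
    rcases h1.lt_or_eq with h | h
    · exact h
    · rw [← h] at h3'; linarith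
  have hbelow : ∀ x, a ≤ x → x < sInf S → 0 < g x := by
    intro x hax hx
    by_contra! h
    exact absurd (csInf_le hbd ⟨⟨hax, hx.le.trans h2⟩, h⟩) (not_le.2 hx)
  refine ⟨sInf S, hlt, h2, ?_, hbelow⟩
  obtain ⟨z, hz, hz0⟩ := intermediate_value_Icc' h1 (hc.mono (Icc_subset_Icc_right h2))
    (show (0 : ℝ) ∈ Icc (g (sInf S)) (g a) from ⟨h3', ha.le⟩)
  rcases hz.2.lt_or_eq with h | h
  · have := hbelow z hz.1 h; linarith
  · rw [← h]; exact hz0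

theorem deriv_nonpos_of_pos_left {g : ℝ → ℝ} {a c d : ℝ} (hac : a < c) (hd : HasDerivAt g d c)
    (h0 : g c = 0) (hp : ∀ x, a < x → x < c → 0 < g x) : d ≤ 0 := by
  have h := hd.tendsto_slope
  have h2 := h.mono_left (nhdsWithin_mono c (show Iio c ⊆ {c}ᶜ from fun x hx => ne_of_lt hx))
  refine le_of_tendsto h2 ?_
  filter_upwards [Ioo_mem_nhdsLT hac] with x hx
  rw [slope_def_field, h0, sub_zero]
  exact div_nonpos_of_nonneg_of_nonpos (hp x hx.1 hx.2).le (sub_nonpos.2 hx.2.le)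

theorem hasDerivAt_pow_div {r : ℝ} (hr : 0 < r) (k : ℕ) :
    HasDerivAt (fun x : ℝ => x ^ k) (k / r * r ^ k) r := by
  refine HasDerivAt.congr_deriv (hasDerivAt_pow k r) ?_
  rcases k with _ | k
  · simp
  · simp only [Nat.add_sub_cancel, pow_succ]
    field_simp

/-- Derivative of the weighted Wronskian of `w` and a solution `v` of the linear equation
`v'' + (k/r) v' + q v = 0`. -/
theorem hasDerivAt_wronskian {w w' v v' : ℝ → ℝ} {w2 q r : ℝ} (k : ℕ) (hr : 0 < r)
    (hw : HasDerivAt w (w' r) r) (hw' : HasDerivAt w' w2 r)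
    (hv : HasDerivAt v (v' r) r) (hv' : HasDerivAt v' (-(k / r * v' r) - q * v r) r) :
    HasDerivAt (fun x => x ^ k * (w x * v' x - w' x * v x))
      (-(r ^ k * v r * (w2 + k / r * w' r + q * w r))) r := by
  refine HasDerivAt.congr_deriv ((hasDerivAt_pow_div hr k).mul ((hw.mul hv').sub (hw'.mul hv))) ?_
  ring

/-- A positive decaying radial solution, with `k = n - 1`. -/
structure GroundState (k : ℕ) (p : ℝ) (u u' : ℝ → ℝ) : Prop where
  one_lt : 1 < p
  two_le : 2 ≤ k
  deriv_zero : u' 0 = 0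
  cont : ContinuousOn u (Ici 0)
  cont_deriv : ContinuousOn u' (Ici 0)
  hasDerivAt : ∀ r, 0 < r → HasDerivAt u (u' r) r
  hasDerivAt_deriv : ∀ r, 0 < r →
    HasDerivAt u' (-(k / r * u' r) - (u r ^ (p - 1) - 1) * u r) r
  pos : ∀ r, 0 ≤ r → 0 < u r
  tendsto : Tendsto u atTop (nhds 0)
  tendsto_deriv : Tendsto u' atTop (nhds 0)

/-- A solution of the equation linearized at `u`, with `k = n - 1`. -/
structure LinearizedSolution (k : ℕ) (p : ℝ) (u v v' : ℝ → ℝ) : Prop where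
  init : v 0 = 1
  cont : ContinuousOn v (Ici 0)
  cont_deriv : ContinuousOn v' (Ici 0)
  hasDerivAt : ∀ r, 0 < r → HasDerivAt v (v' r) r
  hasDerivAt_deriv : ∀ r, 0 < r →
    HasDerivAt v' (-(k / r * v' r) - (p * u r ^ (p - 1) - 1) * v r) r

namespace GroundState

variable {k : ℕ} {p : ℝ} {u u' v v' : ℝ → ℝ}

theorem hasDerivAt_rpow (h : GroundState k p u u') {r : ℝ} (hr : 0 < r) :
    HasDerivAt (fun x => u x ^ (p - 1)) ((p - 1) * u r ^ (p - 1) / u r * u' r) r := by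
  have hp := h.pos r hr.le
  refine HasDerivAt.congr_deriv ((h.hasDerivAt r hr).rpow_const (p := p - 1) (Or.inl hp.ne')) ?_
  rw [Real.rpow_sub_one hp.ne' (p - 1)]
  ring

theorem cont_rpow (h : GroundState k p u u') : ContinuousOn (fun x => u x ^ (p - 1)) (Ici 0) :=
  h.cont.rpow_const fun x hx => Or.inl (h.pos x hx).ne'

theorem hasDerivAt_flux (h : GroundState k p u u') {r : ℝ} (hr : 0 < r) :
    HasDerivAt (fun x => x ^ k * u' x) (-(r ^ k * ((u r ^ (p - 1) - 1) * u r))) r := by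
  refine HasDerivAt.congr_deriv ((hasDerivAt_pow_div hr k).mul (h.hasDerivAt_deriv r hr)) ?_
  ring

theorem cont_flux (h : GroundState k p u u') : ContinuousOn (fun x => x ^ k * u' x) (Ici 0) :=
  (continuousOn_pow k).mul h.cont_deriv

theorem rpow_lt_one_iff (h : GroundState k p u u') {r : ℝ} (hr : 0 ≤ r) :
    u r ^ (p - 1) < 1 ↔ u r < 1 :=
  Real.rpow_lt_one_iff_of_pos (h.pos r hr) |>.trans (by
    have := h.one_lt
    constructor
    · rintro (⟨_, h2⟩ | ⟨h1, _⟩)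
      · linarith
      · exact h1
    · intro h1; right; exact ⟨h1, by linarith⟩)

/-- Past the last crossing of the value `1`, the ground state stays below `1`. -/
theorem lt_one_of_unique (h : GroundState k p u u') {r₁ : ℝ} (hr₁ : 0 < r₁)
    (huniq : ∀ r, 0 < r → u r = 1 → r = r₁) {r : ℝ} (hr : r₁ < r) : u r < 1 := by
  by_contra! h1
  obtain ⟨R, hR1, hR2⟩ := ((h.tendsto.eventually_lt_const one_pos).and
    (eventually_gt_atTop r)).exists
  obtain ⟨z, hz, hz1⟩ := intermediate_value_Icc' hR2.le
    (h.cont.mono fun x hx => (hr₁.trans hr).le.trans hx.1)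
    (show (1 : ℝ) ∈ Icc (u R) (u r) from ⟨hR1.le, h1⟩)
  have := huniq z (by linarith [hz.1]) hz1
  linarith [hz.1]

theorem not_forall_deriv_pos (h : GroundState k p u u') {a : ℝ} (ha : 0 < a)
    : ¬ ∀ r, a < r → 0 < u' r := by
  intro hd
  obtain ⟨R, hR1, hR2⟩ := ((h.tendsto.eventually_lt_const (h.pos a ha.le)).and
    (eventually_gt_atTop a)).exists
  have := lt_of_hasDerivAt_pos hR2 (h.cont.mono fun x hx => ha.le.trans hx.1)
    (fun x hx => h.hasDerivAt x (ha.trans hx.1)) (fun x hx => hd x hx.1)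
  linarith

theorem deriv_pos_of_nonneg (h : GroundState k p u u') {a b : ℝ} (ha : 0 ≤ a) (hab : a < b)
    (h0 : 0 ≤ a ^ k * u' a) (hlt : ∀ r ∈ Ioo a b, u r < 1) : 0 < u' b := by
  have := lt_of_hasDerivAt_pos hab (h.cont_flux.mono fun x hx => ha.trans hx.1)
    (fun x hx => h.hasDerivAt_flux (ha.trans_lt hx.1)) (fun x hx => by
      have hx0 : 0 < x := ha.trans_lt hx.1
      have h1 := (h.rpow_lt_one_iff hx0.le).2 (hlt x hx)
      have h2 := mul_pos (sub_pos.2 h1) (h.pos x hx0.le)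
      have h3 := mul_pos (pow_pos hx0 k) h2
      linarith)
  have hb : 0 < b ^ k := pow_pos (ha.trans_lt hab) k
  exact (pos_iff_pos_of_mul_pos (h0.trans_lt this)).1 hb

theorem one_lt_of_unique (h : GroundState k p u u') {r₁ : ℝ} (hr₁ : 0 < r₁)
    (huniq : ∀ r, 0 < r → u r = 1 → r = r₁) {r : ℝ} (hr : 0 < r) (hr2 : r < r₁) : 1 < u r := by
  by_contra! h1
  have hlt : ∀ s ∈ Ioo 0 r₁, u s < 1 := by
    intro s hs
    by_contra! h2
    have hc : ContinuousOn u (uIcc r s) := h.cont.mono fun x hx =>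
      (le_min hr.le hs.1.le).trans hx.1
    obtain ⟨z, hz, hz1⟩ := intermediate_value_uIcc hc
      (show (1 : ℝ) ∈ uIcc (u r) (u s) from by rw [uIcc_of_le (h1.trans h2)]; exact ⟨h1, h2⟩)
    have h3 := huniq z ((lt_min hr hs.1).trans_le hz.1) hz1
    have h4 := hz.2.trans_lt (max_lt hr2 hs.2)
    linarith
  have h5 := h.deriv_pos_of_nonneg le_rfl hr₁ (by simp [h.deriv_zero]) hlt
  exact h.not_forall_deriv_pos hr₁ fun s hs =>
    h.deriv_pos_of_nonneg hr₁.le hs (mul_pos (pow_pos hr₁ k) h5).le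
      fun x hx => h.lt_one_of_unique hr₁ huniq hx.1

theorem deriv_neg (h : GroundState k p u u') {r₁ : ℝ} (hr₁ : 0 < r₁)
    (huniq : ∀ r, 0 < r → u r = 1 → r = r₁) {r : ℝ} (hr : 0 < r) : u' r < 0 := by
  rcases le_or_gt r r₁ with hle | hgt
  · have := lt_of_hasDerivAt_neg hr (h.cont_flux.mono fun x hx => hx.1)
      (fun x hx => h.hasDerivAt_flux hx.1) (fun x hx => by
        have h1 := h.one_lt_of_unique hr₁ huniq hx.1 (hx.2.trans_le hle)
        have h2 := Real.one_lt_rpow h1 (sub_pos.2 h.one_lt)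
        have h3 := mul_pos (pow_pos hx.1 k) (mul_pos (sub_pos.2 h2) (h.pos x hx.1.le))
        linarith)
    simp only [h.deriv_zero, mul_zero] at this
    by_contra! h1
    have := mul_nonneg (pow_pos hr k).le h1
    linarith
  · by_contra! h1
    exact h.not_forall_deriv_pos hr fun s hs =>
      h.deriv_pos_of_nonneg hr.le hs (mul_nonneg (pow_pos hr k).le h1)
        fun x hx => h.lt_one_of_unique hr₁ huniq (hgt.trans hx.1)

theorem strictAnti (h : GroundState k p u u') (hneg : ∀ r, 0 < r → u' r < 0) {a b : ℝ}
    (ha : 0 ≤ a) (hab : a < b) : u b < u a :=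
  lt_of_hasDerivAt_neg hab (h.cont.mono fun _ hx => ha.trans hx.1)
    (fun x hx => h.hasDerivAt x (ha.trans_lt hx.1)) (fun x hx => hneg x (ha.trans_lt hx.1))

theorem rpow_lt_rpow_of_lt (h : GroundState k p u u') (hneg : ∀ r, 0 < r → u' r < 0) {a b : ℝ}
    (ha : 0 ≤ a) (hab : a < b) : u b ^ (p - 1) < u a ^ (p - 1) :=
  Real.rpow_lt_rpow (h.pos b (ha.trans hab.le)).le (h.strictAnti hneg ha hab)
    (sub_pos.2 h.one_lt)

theorem tendsto_rpow (h : GroundState k p u u') :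
    Tendsto (fun x => u x ^ (p - 1)) atTop (nhds 0) := by
  have hp := sub_pos.2 h.one_lt
  have := h.tendsto.rpow_const (p := p - 1) (Or.inr hp.le)
  rwa [Real.zero_rpow hp.ne'] at this

/-- The energy `u'^2/2 + F(u)` is nonnegative. -/
theorem energy_nonneg (h : GroundState k p u u') {r : ℝ} (hr : 0 < r) :
    0 ≤ u' r ^ 2 / 2 - u r ^ 2 / 2 + u r ^ (p - 1) * u r ^ 2 / (p + 1) := by
  set E : ℝ → ℝ := fun x => u' x ^ 2 / 2 - u x ^ 2 / 2 + u x ^ (p - 1) * u x ^ 2 / (p + 1) with hE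
  have hp1 : 0 < p + 1 := by linarith [h.one_lt]
  have hd : ∀ x, 0 < x → HasDerivAt E (-(k / x * u' x ^ 2)) x := by
    intro x hx
    refine HasDerivAt.congr_deriv (((((h.hasDerivAt_deriv x hx).pow 2).div_const 2).sub
      (((h.hasDerivAt x hx).pow 2).div_const 2)).add
      (((h.hasDerivAt_rpow hx).mul ((h.hasDerivAt x hx).pow 2)).div_const (p + 1))) ?_
    have := (h.pos x hx.le).ne'
    simp only [Pi.pow_apply]
    field_simp
    ring
  have hlim : Tendsto E atTop (nhds 0) := by
    have := (((h.tendsto_deriv.pow 2).div_const 2).sub ((h.tendsto.pow 2).div_const 2)).add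
      ((h.tendsto_rpow.mul (h.tendsto.pow 2)).div_const (p + 1))
    simpa using this
  refine le_of_tendsto hlim ?_
  filter_upwards [eventually_gt_atTop r] with s hs
  exact le_of_hasDerivAt_nonpos hs
    (fun x hx => (hd x (hr.trans_le hx.1)).continuousAt.continuousWithinAt)
    (fun x hx => hd x (hr.trans hx.1)) (fun x hx => by
      have : 0 < x := hr.trans hx.1
      have : 0 ≤ k / x * u' x ^ 2 := by positivity
      linarith)

theorem exists_exp_bound (h : GroundState k p u u') (hneg : ∀ r, 0 < r → u' r < 0) :
    ∃ C, ∀ᶠ r in atTop, u r ≤ C * Real.exp (-(1 / 2) * r) := by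
  have hp1 : 0 < p + 1 := by linarith [h.one_lt]
  obtain ⟨R, hR⟩ := ((h.tendsto_rpow.eventually_lt_const
    (show 0 < 3 / 8 * (p + 1) by positivity)).and (eventually_gt_atTop 0)).exists_forall_of_atTop
  have hR0 : 0 < R := (hR R le_rfl).2
  have hd : ∀ r, R ≤ r → u' r + 1 / 2 * u r ≤ 0 := by
    intro r hr
    obtain ⟨h1, h2⟩ := hR r hr
    have h3 := h.energy_nonneg h2
    have h4 : u r ^ (p - 1) * u r ^ 2 / (p + 1) ≤ 3 / 8 * u r ^ 2 := by
      rw [div_le_iff₀ hp1]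
      nlinarith [sq_nonneg (u r)]
    have h5 := hneg r h2
    have h6 := h.pos r h2.le
    nlinarith
  refine ⟨u R * Real.exp (1 / 2 * R), ?_⟩
  filter_upwards [eventually_gt_atTop R] with r hr
  have hD : ∀ x, R ≤ x → HasDerivAt (fun x => u x * Real.exp (1 / 2 * x))
      ((u' x + 1 / 2 * u x) * Real.exp (1 / 2 * x)) x := by
    intro x hx
    refine HasDerivAt.congr_deriv ((h.hasDerivAt x (hR0.trans_le hx)).mul
      (((hasDerivAt_id x).const_mul (1 / 2)).exp)) ?_
    simp only [id]
    ring
  have h7 := le_of_hasDerivAt_nonpos hr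
    (fun x hx => (hD x hx.1).continuousAt.continuousWithinAt)
    (fun x hx => hD x hx.1.le)
    (fun x hx => mul_nonpos_of_nonpos_of_nonneg (hd x hx.1.le) (Real.exp_pos _).le)
  have h8 := mul_le_mul_of_nonneg_right h7 (Real.exp_pos (-(1 / 2) * r)).le
  rwa [mul_assoc, ← Real.exp_add, show 1 / 2 * r + -(1 / 2) * r = 0 by ring, Real.exp_zero,
    mul_one] at h8

theorem tendsto_pow_mul_exp (C : ℝ) (m : ℕ) :
    Tendsto (fun r : ℝ => r ^ m * (C * Real.exp (-(1 / 2) * r))) atTop (nhds 0) := by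
  have h1 := (Real.tendsto_pow_mul_exp_neg_atTop_nhds_zero m).comp
    (tendsto_id.const_mul_atTop (show (0 : ℝ) < 1 / 2 by norm_num))
  have h2 := h1.const_mul (C * 2 ^ m)
  rw [mul_zero] at h2
  refine h2.congr fun r => ?_
  simp only [Function.comp, id, mul_pow, one_div, inv_pow, neg_mul]
  field_simp

theorem tendsto_pow_mul (h : GroundState k p u u') (hneg : ∀ r, 0 < r → u' r < 0) (m : ℕ) :
    Tendsto (fun r => r ^ m * u r) atTop (nhds 0) := by
  obtain ⟨C, hC⟩ := h.exists_exp_bound hneg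
  refine squeeze_zero' ?_ ?_ (tendsto_pow_mul_exp C m)
  · filter_upwards [eventually_gt_atTop 0] with r hr
    exact mul_nonneg (pow_pos hr m).le (h.pos r hr.le).le
  · filter_upwards [eventually_gt_atTop 0, hC] with r hr hr2
    exact mul_le_mul_of_nonneg_left hr2 (pow_pos hr m).le

theorem neg_deriv_le (h : GroundState k p u u') (hneg : ∀ r, 0 < r → u' r < 0) :
    ∀ᶠ r in atTop, -u' r ≤ u (r - 1) := by
  obtain ⟨R, hR⟩ := ((h.tendsto.eventually_lt_const one_pos).and
    (eventually_gt_atTop 0)).exists_forall_of_atTop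
  filter_upwards [eventually_gt_atTop (R + 1)] with r hr
  have hR0 : 0 < R := (hR R le_rfl).2
  obtain ⟨c, hc, hce⟩ := exists_hasDerivAt_eq_slope u u' (show r - 1 < r by linarith)
    (h.cont.mono fun x hx => by simp only [mem_Ici]; linarith [hx.1])
    (fun x hx => h.hasDerivAt x (by linarith [hx.1]))
  rw [show r - (r - 1) = 1 by ring, div_one] at hce
  have h1 := lt_of_hasDerivAt_pos hc.2
    (h.cont_deriv.mono fun x hx => by simp only [mem_Ici]; linarith [hx.1, hc.1])
    (fun x hx => h.hasDerivAt_deriv x (by linarith [hx.1, hc.1])) (fun x hx => by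
      have hx0 : 0 < x := by linarith [hx.1, hc.1]
      have h2 := (h.rpow_lt_one_iff hx0.le).2 (hR x (by linarith [hx.1, hc.1])).1
      have h3 := mul_pos (sub_pos.2 h2) (h.pos x hx0.le)
      have h4 : 0 ≤ k / x * -u' x :=
        mul_nonneg (by positivity) (neg_nonneg.2 (hneg x hx0).le)
      linarith)
  have := h.pos r (by linarith)
  linarith

theorem tendsto_pow_mul_deriv (h : GroundState k p u u') (hneg : ∀ r, 0 < r → u' r < 0) (m : ℕ) :
    Tendsto (fun r => r ^ m * u' r) atTop (nhds 0) := by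
  obtain ⟨C, hC⟩ := h.exists_exp_bound hneg
  have hC' := (tendsto_atTop_add_const_right atTop (-1 : ℝ) tendsto_id).eventually hC
  have key : Tendsto (fun r => r ^ m * -u' r) atTop (nhds 0) := by
    refine squeeze_zero' ?_ ?_ (tendsto_pow_mul_exp (C * Real.exp (1 / 2)) m)
    · filter_upwards [eventually_gt_atTop 0] with r hr
      exact mul_nonneg (pow_pos hr m).le (neg_nonneg.2 (hneg r hr).le)
    · filter_upwards [eventually_gt_atTop 0, hC', h.neg_deriv_le hneg] with r hr hr2 hr3
      refine mul_le_mul_of_nonneg_left (hr3.trans ?_) (pow_pos hr m).le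
      rw [mul_assoc, ← Real.exp_add]
      rw [show r - 1 = id r + -1 by simp only [id]; ring,
        show 1 / 2 + -(1 / 2) * r = -(1 / 2) * (id r + -1) by simp only [id]; ring]
      exact hr2
  simpa using key.neg

/-- Positivity of the Pohozaev functional. -/
theorem pohozaev_pos (h : GroundState k p u u') (hneg : ∀ r, 0 < r → u' r < 0) {r : ℝ}
    (hr : 0 < r) :
    0 < r ^ (k + 1) * (u' r ^ 2 / 2 - u r ^ 2 / 2 + u r ^ (p - 1) * u r ^ 2 / (p + 1))
      + ((k : ℝ) - 1) / 2 * (r ^ k * (u r * u' r)) := by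
  set P : ℝ → ℝ := fun r =>
    r ^ (k + 1) * (u' r ^ 2 / 2 - u r ^ 2 / 2 + u r ^ (p - 1) * u r ^ 2 / (p + 1))
      + ((k : ℝ) - 1) / 2 * (r ^ k * (u r * u' r)) with hP
  have hp1 : 0 < p + 1 := by linarith [h.one_lt]
  set c : ℝ := ((k : ℝ) + 1) / (p + 1) - ((k : ℝ) - 1) / 2 with hcdef
  have hk : k ≠ 0 := by have := h.two_le; omega
  have hd : ∀ x, 0 < x → HasDerivAt P (x ^ k * u x ^ 2 * (c * u x ^ (p - 1) - 1)) x := by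
    intro x hx
    have hu := h.hasDerivAt x hx
    have hu' := h.hasDerivAt_deriv x hx
    refine HasDerivAt.congr_deriv (((hasDerivAt_pow_div hx (k + 1)).mul ((((hu'.pow 2).div_const 2).sub
      ((hu.pow 2).div_const 2)).add
      (((h.hasDerivAt_rpow hx).mul (hu.pow 2)).div_const (p + 1)))).add
      (((hasDerivAt_pow_div hx k).mul (hu.mul hu')).const_mul (((k : ℝ) - 1) / 2))) ?_
    have := (h.pos x hx.le).ne'
    simp only [Pi.pow_apply, Pi.mul_apply, Pi.sub_apply, Pi.add_apply, hcdef]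
    push_cast
    rw [pow_succ]
    field_simp
    ring
  have hcont : ContinuousOn P (Ici 0) := by
    have h1 := h.cont
    have h2 := h.cont_deriv
    have h3 := h.cont_rpow
    fun_prop
  have hlim : Tendsto P atTop (nhds 0) := by
    have h1 := (h.tendsto_pow_mul_deriv hneg (k + 1)).mul h.tendsto_deriv
    have h2 := (h.tendsto_pow_mul hneg (k + 1)).mul h.tendsto
    have h3 := h2.mul h.tendsto_rpow
    have h4 := (h.tendsto_pow_mul hneg k).mul h.tendsto_deriv
    have := (((h1.div_const 2).sub (h2.div_const 2)).add (h3.div_const (p + 1))).add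
      (h4.const_mul (((k : ℝ) - 1) / 2))
    simp only [mul_zero, zero_div, sub_zero, add_zero] at this
    refine this.congr fun x => ?_
    simp only [hP]
    ring
  change 0 < P r
  rcases le_or_gt 1 (c * u r ^ (p - 1)) with h1 | h1
  · have hG := Real.rpow_pos_of_pos (h.pos r hr.le) (p - 1)
    have hc : 0 < c := by
      by_contra! h2
      linarith [mul_nonpos_of_nonpos_of_nonneg h2 hG.le]
    have h0 : P 0 = 0 := by simp [hP, hk]
    rw [← h0]
    refine lt_of_hasDerivAt_pos hr (hcont.mono fun x hx => hx.1) (fun x hx => hd x hx.1) ?_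
    intro x hx
    have h2 := mul_lt_mul_of_pos_left (h.rpow_lt_rpow_of_lt hneg hx.1.le hx.2) hc
    exact mul_pos (mul_pos (pow_pos hx.1 k) (pow_pos (h.pos x hx.1.le) 2)) (by linarith)
  · have hanti : ∀ a b, r ≤ a → a < b → P b < P a := by
      intro a b ha hab
      refine lt_of_hasDerivAt_neg hab (hcont.mono fun x hx => (hr.le.trans ha).trans hx.1)
        (fun x hx => hd x ((hr.trans_le ha).trans hx.1)) ?_
      intro x hx
      have hx0 : 0 < x := (hr.trans_le ha).trans hx.1
      have h2 := h.rpow_lt_rpow_of_lt hneg hr.le (ha.trans_lt hx.1)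
      have h3 := Real.rpow_pos_of_pos (h.pos x hx0.le) (p - 1)
      have h4 : c * u x ^ (p - 1) < 1 := by
        rcases le_or_gt c 0 with hc | hc
        · linarith [mul_nonpos_of_nonpos_of_nonneg hc h3.le]
        · linarith [mul_lt_mul_of_pos_left h2 hc]
      exact mul_neg_of_pos_of_neg (mul_pos (pow_pos hx0 k) (pow_pos (h.pos x hx0.le) 2))
        (by linarith)
    have h5 : 0 ≤ P (r + 1) := by
      refine le_of_tendsto hlim ?_
      filter_upwards [eventually_gt_atTop (r + 1)] with s hs
      exact (hanti _ _ (by linarith) hs).le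
    exact h5.trans_lt (hanti r (r + 1) le_rfl (by linarith))

/-- The function `-r u'/u` is strictly increasing. -/
theorem strictMono_logDeriv (h : GroundState k p u u') (hneg : ∀ r, 0 < r → u' r < 0) {a b : ℝ}
    (ha : 0 < a) (hab : a < b) : -(a * u' a) / u a < -(b * u' b) / u b := by
  have hd : ∀ x, 0 < x → HasDerivAt (fun x => -(x * u' x) / u x)
      ((-(u' x + x * (-(k / x * u' x) - (u x ^ (p - 1) - 1) * u x)) * u x
        - -(x * u' x) * u' x) / u x ^ 2) x := by
    intro x hx
    refine HasDerivAt.congr_deriv ((((hasDerivAt_id x).mul (h.hasDerivAt_deriv x hx)).neg).div (h.hasDerivAt x hx)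
      (h.pos x hx.le).ne') ?_
    simp only [id, Pi.neg_apply, Pi.mul_apply]
    ring
  refine lt_of_hasDerivAt_pos hab
    (fun x hx => (hd x (ha.trans_le hx.1)).continuousAt.continuousWithinAt)
    (fun x hx => hd x (ha.trans hx.1)) ?_
  intro x hx
  have hx0 := ha.trans hx.1
  have hu := h.pos x hx0.le
  refine div_pos ?_ (pow_pos hu 2)
  have h1 := h.pohozaev_pos hneg hx0
  have hp1 : 0 < p + 1 := by linarith [h.one_lt]
  have hG := Real.rpow_pos_of_pos hu (p - 1)
  set G := u x ^ (p - 1)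
  have h2 : x ^ (k + 1) * (u' x ^ 2 / 2 - u x ^ 2 / 2 + G * u x ^ 2 / (p + 1))
      + ((k : ℝ) - 1) / 2 * (x ^ k * (u x * u' x))
      = x ^ k / 2 * (x * u' x ^ 2 - x * u x ^ 2 + x * (2 / (p + 1)) * (G * u x ^ 2)
        + ((k : ℝ) - 1) * (u x * u' x)) := by
    rw [pow_succ]; ring
  rw [h2] at h1
  have h3 := (pos_iff_pos_of_mul_pos h1).1 (by positivity)
  have h4 : 2 / (p + 1) < 1 := by rw [div_lt_one hp1]; linarith [h.one_lt]
  have h5 : 0 < x * (G * u x ^ 2) * (1 - 2 / (p + 1)) :=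
    mul_pos (by positivity) (by linarith)
  have h6 : -(u' x + x * (-(k / x * u' x) - (G - 1) * u x)) * u x - -(x * u' x) * u' x
      = x * u' x ^ 2 - x * u x ^ 2 + x * (G * u x ^ 2) + ((k : ℝ) - 1) * (u x * u' x) := by
    field_simp
    ring
  rw [h6]
  linarith

theorem cont_wronskian (hv : LinearizedSolution k p u v v')
    {w w' : ℝ → ℝ} (hw : ContinuousOn w (Ici 0)) (hw' : ContinuousOn w' (Ici 0)) :
    ContinuousOn (fun x => x ^ k * (w x * v' x - w' x * v x)) (Ici 0) := by
  have h1 := hv.cont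
  have h2 := hv.cont_deriv
  fun_prop

theorem deriv_neg_of_first_zero (h : GroundState k p u u') (hv : LinearizedSolution k p u v v')
    {τ : ℝ} (hτ : 0 < τ) (h0 : v τ = 0) (hp : ∀ r, 0 ≤ r → r < τ → 0 < v r) : v' τ < 0 := by
  have hk : k ≠ 0 := by have := h.two_le; omega
  have h1 := lt_of_hasDerivAt_neg hτ
    ((cont_wronskian hv h.cont h.cont_deriv).mono fun x hx => hx.1)
    (fun x hx => hasDerivAt_wronskian k hx.1 (h.hasDerivAt x hx.1) (h.hasDerivAt_deriv x hx.1)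
      (hv.hasDerivAt x hx.1) (hv.hasDerivAt_deriv x hx.1)) (fun x hx => by
      have hu := h.pos x hx.1.le
      have hG := Real.rpow_pos_of_pos hu (p - 1)
      have h2 : 0 < (p - 1) * (u x ^ (p - 1) * u x) :=
        mul_pos (sub_pos.2 h.one_lt) (mul_pos hG hu)
      refine neg_neg_of_pos (mul_pos (mul_pos (pow_pos hx.1 k) (hp x hx.1.le hx.2)) ?_)
      linarith)
  simp only [h0, mul_zero, sub_zero, zero_pow hk, zero_mul] at h1
  have h2 := mul_pos (pow_pos hτ k) (h.pos τ hτ.le)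
  by_contra! h3
  have := mul_nonneg h2.le h3
  linarith

theorem convexity_pos {p s : ℝ} (hp : 1 < p) (hs : 1 < s) :
    0 < (p - 1) * (s ^ (p - 1) * s) - p * s ^ (p - 1) + 1 := by
  have hs0 : 0 < s := one_pos.trans hs
  have hinv : s⁻¹ < 1 := inv_lt_one_of_one_lt₀ hs
  have hinv0 : 0 < s⁻¹ := inv_pos.2 hs0
  have h1 := one_add_mul_self_lt_rpow_one_add (s := s⁻¹ - 1) (by linarith) (by linarith) hp
  rw [show 1 + (s⁻¹ - 1) = s⁻¹ by ring, Real.inv_rpow hs0.le] at h1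
  have hP := Real.rpow_pos_of_pos hs0 p
  have h2 := mul_lt_mul_of_pos_left h1 hP
  rw [mul_inv_cancel₀ hP.ne'] at h2
  have h3 : s ^ p = s ^ (p - 1) * s := by
    rw [← Real.rpow_add_one hs0.ne', sub_add_cancel]
  rw [h3] at h2
  have h4 : s ^ (p - 1) * s * (1 + p * (s⁻¹ - 1))
      = s ^ (p - 1) * s + p * s ^ (p - 1) - p * (s ^ (p - 1) * s) := by
    field_simp
    ring
  linarith

/-- The linearized solution has a zero before `u` crosses the value `1`. -/
theorem exists_nonpos (h : GroundState k p u u') (hv : LinearizedSolution k p u v v')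
    {r₁ : ℝ} (hr₁ : 0 < r₁) (hur₁ : u r₁ = 1) (hneg : ∀ r, 0 < r → u' r < 0) :
    ∃ b, 0 < b ∧ b < r₁ ∧ v b ≤ 0 := by
  by_contra! hcon
  have hk : k ≠ 0 := by have := h.two_le; omega
  have hvr : 0 ≤ v r₁ := by
    have h1 := (hv.hasDerivAt r₁ hr₁).continuousAt.tendsto.mono_left
      (nhdsWithin_le_nhds (s := Iio r₁))
    refine ge_of_tendsto h1 ?_
    filter_upwards [Ioo_mem_nhdsLT hr₁] with x hx
    exact (hcon x hx.1 hx.2).le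
  have h1 := lt_of_hasDerivAt_neg hr₁
    ((cont_wronskian hv (w := fun x => u x - 1) (h.cont.sub continuousOn_const)
      h.cont_deriv).mono fun x hx => hx.1)
    (fun x hx => hasDerivAt_wronskian k hx.1 ((h.hasDerivAt x hx.1).sub_const 1)
      (h.hasDerivAt_deriv x hx.1)
      (hv.hasDerivAt x hx.1) (hv.hasDerivAt_deriv x hx.1)) (fun x hx => by
      have hu : 1 < u x := hur₁ ▸ h.strictAnti hneg hx.1.le hx.2
      have h2 := convexity_pos h.one_lt hu
      refine neg_neg_of_pos (mul_pos (mul_pos (pow_pos hx.1 k) (hcon x hx.1 hx.2)) ?_)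
      linarith)
  simp only [hur₁, sub_self, zero_mul, zero_sub, zero_pow hk] at h1
  have h2 := mul_nonneg (mul_nonneg (pow_pos hr₁ k).le (neg_nonneg.2 (hneg r₁ hr₁).le)) hvr
  linarith

/-- Wronskian of the generator `r u' + l u` with `v`, written without `u''`. -/
noncomputable def scalingWronskian (k : ℕ) (p l : ℝ) (u u' v v' : ℝ → ℝ) (x : ℝ) : ℝ :=
  x ^ k * ((x * u' x + l * u x) * v' x
    - ((l + 1 - k) * u' x - x * ((u x ^ (p - 1) - 1) * u x)) * v x)

theorem cont_scalingWronskian (h : GroundState k p u u') (hv : LinearizedSolution k p u v v')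
    (l : ℝ) : ContinuousOn (scalingWronskian k p l u u' v v') (Ici 0) := by
  have h1 := h.cont
  have h2 := h.cont_deriv
  have h3 := h.cont_rpow
  exact cont_wronskian hv (by fun_prop) (by fun_prop)

theorem hasDerivAt_scalingWronskian (h : GroundState k p u u')
    (hv : LinearizedSolution k p u v v') (l : ℝ) {r : ℝ} (hr : 0 < r) :
    HasDerivAt (scalingWronskian k p l u u' v v')
      (-(r ^ k * v r * (u r * (2 - (2 - l * (p - 1)) * u r ^ (p - 1))))) r := by
  have hu := h.hasDerivAt r hr
  have hu' := h.hasDerivAt_deriv r hr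
  have hG := h.hasDerivAt_rpow hr
  have hw : HasDerivAt (fun x => x * u' x + l * u x)
      ((l + 1 - k) * u' r - r * ((u r ^ (p - 1) - 1) * u r)) r := by
    refine (((hasDerivAt_id r).mul hu').add (hu.const_mul l)).congr_deriv ?_
    simp only [id]
    field_simp
    ring
  have hw' : HasDerivAt (fun x => (l + 1 - k) * u' x - x * ((u x ^ (p - 1) - 1) * u x)) _ r :=
    (hu'.const_mul (l + 1 - k)).sub ((hasDerivAt_id r).mul ((hG.sub_const 1).mul hu))
  have := hasDerivAt_wronskian k hr hw hw' (hv.hasDerivAt r hr) (hv.hasDerivAt_deriv r hr)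
  refine this.congr_deriv ?_
  have hpos := (h.pos r hr.le).ne'
  simp only [id]
  field_simp
  ring

/-- The generator `r u' + l u` vanishes at `τ` for this value of `l`. -/
theorem scaling_eq_zero (h : GroundState k p u u') {τ : ℝ} (hτ : 0 < τ) :
    τ * u' τ + -(τ * u' τ) / u τ * u τ = 0 := by
  rw [div_mul_cancel₀ _ (h.pos τ hτ.le).ne']; ring

theorem scaling_neg (h : GroundState k p u u') (hneg : ∀ r, 0 < r → u' r < 0) {τ r : ℝ}
    (hτ : 0 < τ) (hr : τ < r) : r * u' r + -(τ * u' τ) / u τ * u r < 0 := by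
  have h1 := h.strictMono_logDeriv hneg hτ hr
  rw [lt_div_iff₀ (h.pos r (hτ.trans hr).le)] at h1
  linarith

theorem scalingWronskian_eq_zero (h : GroundState k p u u') {τ : ℝ} (hτ : 0 < τ) (h0 : v τ = 0) :
    scalingWronskian k p (-(τ * u' τ) / u τ) u u' v v' τ = 0 := by
  simp only [scalingWronskian, h.scaling_eq_zero hτ, h0]
  ring

/-- Past the first zero `τ` of `v`, the Wronskian with the scaling generator vanishing at `τ` is
strictly increasing as long as `v` is negative. -/
theorem scalingWronskian_strictMono (h : GroundState k p u u')
    (hv : LinearizedSolution k p u v v') (hneg : ∀ r, 0 < r → u' r < 0)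
    {τ : ℝ} (hτ : 0 < τ) (h0 : v τ = 0) (hp : ∀ r, 0 ≤ r → r < τ → 0 < v r)
    {a b : ℝ} (ha : τ ≤ a) (hab : a < b) (hvneg : ∀ r ∈ Ioo a b, v r < 0) :
    scalingWronskian k p (-(τ * u' τ) / u τ) u u' v v' a
      < scalingWronskian k p (-(τ * u' τ) / u τ) u u' v v' b := by
  have hk : k ≠ 0 := by have := h.two_le; omega
  have hWτ := h.scalingWronskian_eq_zero (k := k) (p := p) (v' := v') hτ h0
  set l := -(τ * u' τ) / u τ with hl
  have hW0 : scalingWronskian k p l u u' v v' 0 = 0 := by simp [scalingWronskian, hk]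
  obtain ⟨c, hc, hce⟩ := exists_hasDerivAt_eq_zero hτ
    ((h.cont_scalingWronskian hv l).mono fun x hx => hx.1) (hW0.trans hWτ.symm)
    (fun x hx => h.hasDerivAt_scalingWronskian hv l hx.1)
  have hc2 : 2 - (2 - l * (p - 1)) * u c ^ (p - 1) = 0 := by
    have h1 := (pow_pos hc.1 k).ne'
    have h2 := (hp c hc.1.le hc.2).ne'
    have h3 := (h.pos c hc.1.le).ne'
    simpa [h1, h2, h3] using hce
  have hcoef : 0 < 2 - l * (p - 1) := by
    have hG := Real.rpow_pos_of_pos (h.pos c hc.1.le) (p - 1)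
    by_contra! h2
    linarith [mul_nonpos_of_nonpos_of_nonneg h2 hG.le]
  refine lt_of_hasDerivAt_pos hab
    ((h.cont_scalingWronskian hv l).mono fun x hx => (hτ.le.trans ha).trans hx.1)
    (fun x hx => h.hasDerivAt_scalingWronskian hv l ((hτ.trans_le ha).trans hx.1)) ?_
  intro x hx
  have hx0 : 0 < x := (hτ.trans_le ha).trans hx.1
  have h1 := mul_lt_mul_of_pos_left
    (h.rpow_lt_rpow_of_lt hneg hc.1.le (hc.2.trans (ha.trans_lt hx.1))) hcoef
  exact neg_pos.2 (mul_neg_of_neg_of_pos (mul_neg_of_pos_of_neg (pow_pos hx0 k) (hvneg x hx))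
    (mul_pos (h.pos x hx0.le) (by linarith)))

/-- The linearized solution stays negative past its first zero. -/
theorem neg_of_first_zero (h : GroundState k p u u')
    (hv : LinearizedSolution k p u v v') (hneg : ∀ r, 0 < r → u' r < 0)
    {τ : ℝ} (hτ : 0 < τ) (h0 : v τ = 0) (hp : ∀ r, 0 ≤ r → r < τ → 0 < v r)
    {r : ℝ} (hr : τ < r) : v r < 0 := by
  by_contra! hcon
  have hd := h.deriv_neg_of_first_zero hv hτ h0 hp
  have hsl := (hv.hasDerivAt τ hτ).tendsto_slope.mono_left
    (nhdsWithin_mono τ (show Ioi τ ⊆ {τ}ᶜ from fun x hx => ne_of_gt hx))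
  have hev : ∀ᶠ x in nhdsWithin τ (Ioi τ), v x < 0 := by
    filter_upwards [hsl.eventually_lt_const hd, self_mem_nhdsWithin] with x hx1 hx2
    rw [slope_def_field, h0, sub_zero] at hx1
    by_contra! h1
    exact hx1.not_ge (div_nonneg h1 (sub_pos.2 hx2).le)
  obtain ⟨d, hd1, hd2⟩ := (mem_nhdsGT_iff_exists_Ioo_subset' hr).1 hev
  obtain ⟨e, he1, he2⟩ := exists_between (lt_min hd1 hr)
  have her : e < r := he2.trans_le (min_le_right _ _)
  have hed : e < d := he2.trans_le (min_le_left _ _)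
  obtain ⟨c, hc1, -, hc3, hc4⟩ := exists_first_zero (g := fun x => -v x) her.le
    (hv.cont.neg.mono fun x hx => (hτ.trans he1).le.trans hx.1)
    (neg_pos.2 (hd2 ⟨he1, hed⟩)) (neg_nonpos.2 hcon)
  have hτc : τ < c := he1.trans hc1
  have hc0 : 0 < c := hτ.trans hτc
  have hvc : v c = 0 := neg_eq_zero.1 hc3
  have hvneg : ∀ x ∈ Ioo τ c, v x < 0 := by
    intro x hx
    rcases lt_or_ge x e with h1 | h1
    · exact hd2 ⟨hx.1, h1.trans hed⟩
    · exact neg_pos.1 (hc4 x h1 hx.2)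
  have hdc := deriv_nonpos_of_pos_left hτc (hv.hasDerivAt c hc0).neg hc3
    (fun x h1 h2 => neg_pos.2 (hvneg x ⟨h1, h2⟩))
  have hW := h.scalingWronskian_strictMono hv hneg hτ h0 hp le_rfl hτc hvneg
  rw [h.scalingWronskian_eq_zero hτ h0] at hW
  simp only [scalingWronskian, hvc, mul_zero, sub_zero] at hW
  have hw := h.scaling_neg hneg hτ hτc
  have := mul_nonneg (mul_nonneg (pow_pos hc0 k).le (neg_nonneg.2 hw.le)) (neg_nonpos.1 hdc)
  linarith

theorem tendsto_scalingWronskian (h : GroundState k p u u') (hneg : ∀ r, 0 < r → u' r < 0)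
    (l : ℝ) {A B : ℝ} (hA : ∀ᶠ r in atTop, |r ^ k * v' r| ≤ A) (hB : ∀ᶠ r in atTop, |v r| ≤ B) :
    Tendsto (scalingWronskian k p l u u' v v') atTop (nhds 0) := by
  have h1 : Tendsto (fun x => x ^ 1 * u' x + l * u x) atTop (nhds 0) := by
    simpa using (h.tendsto_pow_mul_deriv hneg 1).add (h.tendsto.const_mul l)
  have h2 : Tendsto (fun x => (l + 1 - k) * (x ^ k * u' x)
      - x ^ (k + 1) * u x * (u x ^ (p - 1) - 1)) atTop (nhds 0) := by
    simpa using ((h.tendsto_pow_mul_deriv hneg k).const_mul (l + 1 - k)).sub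
      ((h.tendsto_pow_mul hneg (k + 1)).mul (h.tendsto_rpow.sub_const 1))
  have h3 := h1.zero_mul_isBoundedUnder_le (isBoundedUnder_of_eventually_le (a := A) hA)
  have h4 := h2.zero_mul_isBoundedUnder_le (isBoundedUnder_of_eventually_le (a := B) hB)
  have h5 := h3.sub h4
  rw [sub_zero] at h5
  refine h5.congr fun x => ?_
  simp only [scalingWronskian]
  ring

theorem hasDerivAt_linearized_flux (hv : LinearizedSolution k p u v v') {r : ℝ} (hr : 0 < r) :
    HasDerivAt (fun x => x ^ k * v' x) (r ^ k * ((1 - p * u r ^ (p - 1)) * v r)) r := by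
  refine ((hasDerivAt_pow_div hr k).mul (hv.hasDerivAt_deriv r hr)).congr_deriv ?_
  ring

/-- A linearized solution that is negative and decreasing at some far away point diverges. -/
theorem tendsto_atBot_of_deriv_neg (hv : LinearizedSolution k p u v v') {R : ℝ} (hR : 1 ≤ R)
    (hG : ∀ r, R ≤ r → p * u r ^ (p - 1) < 1 / 2) (hvneg : ∀ r, R ≤ r → v r < 0)
    (hd : v' R < 0) : Tendsto v atTop atBot := by
  have hR0 : 0 < R := one_pos.trans_le hR
  have hfluxd : ∀ r, R ≤ r → HasDerivAt (fun x => x ^ k * v' x)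
      (r ^ k * ((1 - p * u r ^ (p - 1)) * v r)) r :=
    fun r hr => hasDerivAt_linearized_flux hv (hR0.trans_le hr)
  have hd' : ∀ r, R < r → v' r < 0 := by
    intro r hr
    have h1 := lt_of_hasDerivAt_neg hr
      (fun x hx => (hfluxd x hx.1).continuousAt.continuousWithinAt)
      (fun x hx => hfluxd x hx.1.le) (fun x hx =>
        mul_neg_of_pos_of_neg (pow_pos (hR0.trans hx.1) k)
          (mul_neg_of_pos_of_neg (by linarith [hG x hx.1.le]) (hvneg x hx.1.le)))
    by_contra! h2
    linarith [mul_neg_of_pos_of_neg (pow_pos hR0 k) hd,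
      mul_nonneg (pow_pos (hR0.trans hr) k).le h2]
  have hvle : ∀ r, R < r → v r < v R := fun r hr => lt_of_hasDerivAt_neg hr
    (hv.cont.mono fun x hx => hR0.le.trans hx.1) (fun x hx => hv.hasDerivAt x (hR0.trans hx.1))
    (fun x hx => hd' x hx.1)
  set c : ℝ := -v R / (2 * (k + 1)) with hc
  have hc0 : 0 < c := div_pos (neg_pos.2 (hvneg R le_rfl)) (by positivity)
  set K : ℝ := R ^ k * v' R + c * R ^ (k + 1) with hK
  have hbound : ∀ r, R < r → v' r ≤ |K| - c * r := by
    intro r hr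
    have hD : ∀ x, R ≤ x → HasDerivAt (fun x => x ^ k * v' x + c * x ^ (k + 1))
        (x ^ k * ((1 - p * u x ^ (p - 1)) * v x - v R / 2)) x := by
      intro x hx
      have hx0 : 0 < x := hR0.trans_le hx
      refine ((hfluxd x hx).add ((hasDerivAt_pow_div hx0 (k + 1)).const_mul c)).congr_deriv ?_
      rw [hc, pow_succ]
      push_cast
      field_simp
      ring
    have h1 := le_of_hasDerivAt_nonpos hr
      (fun x hx => (hD x hx.1).continuousAt.continuousWithinAt)
      (fun x hx => hD x hx.1.le) (fun x hx => by
        refine mul_nonpos_of_nonneg_of_nonpos (pow_pos (hR0.trans hx.1) k).le ?_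
        have h2 := hvle x hx.1
        have h3 := hvneg x hx.1.le
        have h4 := hG x hx.1.le
        nlinarith)
    have h2 : r ^ k * (v' r + c * r) ≤ |K| := by
      refine le_trans (le_of_eq ?_) (h1.trans (le_abs_self K))
      rw [pow_succ]; ring
    have h3 : 1 ≤ r ^ k := one_le_pow₀ (hR.trans hr.le)
    rcases le_or_gt (v' r + c * r) 0 with h4 | h4
    · linarith [abs_nonneg K]
    · linarith [le_mul_of_one_le_left h4.le h3]
  set S : ℝ := max R ((|K| + 1) / c) with hS
  have hSd : ∀ r, S < r → v' r ≤ -1 := by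
    intro r hr
    have h1 := hbound r ((le_max_left _ _).trans_lt hr)
    have h2 := (div_lt_iff₀ hc0).1 ((le_max_right _ _).trans_lt hr)
    linarith
  have hS0 : 0 < S := hR0.trans_le (le_max_left _ _)
  refine tendsto_atBot_mono' atTop ?_ (
    tendsto_atBot_add_const_left atTop (v S + S) tendsto_neg_atTop_atBot)
  filter_upwards [eventually_gt_atTop S] with r hr
  have h1 := le_of_hasDerivAt_nonpos (g := fun x => v x + x) hr
    ((hv.cont.add continuousOn_id).mono fun x hx => hS0.le.trans hx.1)
    (fun x hx => (hv.hasDerivAt x (hS0.trans hx.1)).add (hasDerivAt_id x))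
    (fun x hx => by linarith [hSd x hx.1])
  linarith

theorem tendsto_atBot (h : GroundState k p u u')
    (hv : LinearizedSolution k p u v v') (hneg : ∀ r, 0 < r → u' r < 0)
    {τ : ℝ} (hτ : 0 < τ) (h0 : v τ = 0) (hp : ∀ r, 0 ≤ r → r < τ → 0 < v r) :
    Tendsto v atTop atBot := by
  have hvneg : ∀ r, τ < r → v r < 0 := fun r hr => h.neg_of_first_zero hv hneg hτ h0 hp hr
  have hlimG := h.tendsto_rpow.const_mul p
  rw [mul_zero] at hlimG
  obtain ⟨R, hR⟩ := ((hlimG.eventually_lt_const (show (0 : ℝ) < 1 / 2 by norm_num)).and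
    ((eventually_gt_atTop τ).and (eventually_ge_atTop 1))).exists_forall_of_atTop
  by_cases hcase : ∃ S, R ≤ S ∧ v' S < 0
  · obtain ⟨S, hS, hd⟩ := hcase
    exact tendsto_atBot_of_deriv_neg hv (hR S hS).2.2 (fun r hr => (hR r (hS.trans hr)).1)
      (fun r hr => hvneg r (hR r (hS.trans hr)).2.1) hd
  · push Not at hcase
    exfalso
    have hR0 : 0 < R := one_pos.trans_le (hR R le_rfl).2.2
    have hA : ∀ᶠ r in atTop, |r ^ k * v' r| ≤ R ^ k * v' R := by
      filter_upwards [eventually_gt_atTop R] with r hr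
      rw [abs_of_nonneg (mul_nonneg (pow_pos (hR0.trans hr) k).le (hcase r hr.le))]
      refine le_of_hasDerivAt_nonpos hr
        (fun x hx => (hasDerivAt_linearized_flux hv
          (hR0.trans_le hx.1)).continuousAt.continuousWithinAt)
        (fun x hx => hasDerivAt_linearized_flux hv (hR0.trans hx.1)) ?_
      intro x hx
      obtain ⟨h1, h2, -⟩ := hR x hx.1.le
      exact mul_nonpos_of_nonneg_of_nonpos (pow_pos (hR0.trans hx.1) k).le
        (mul_nonpos_of_nonneg_of_nonpos (by linarith) (hvneg x h2).le)
    have hB : ∀ᶠ r in atTop, |v r| ≤ -v R := by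
      filter_upwards [eventually_gt_atTop R] with r hr
      rw [abs_of_neg (hvneg r (hR r hr.le).2.1)]
      exact le_of_hasDerivAt_nonpos (g := fun x => -v x) hr
        (hv.cont.neg.mono fun x hx => hR0.le.trans hx.1)
        (fun x hx => (hv.hasDerivAt x (hR0.trans hx.1)).neg)
        (fun x hx => neg_nonpos.2 (hcase x hx.1.le))
    have hlim := h.tendsto_scalingWronskian hneg (-(τ * u' τ) / u τ) hA hB
    have hτR := (hR R le_rfl).2.1
    have hWR := h.scalingWronskian_strictMono hv hneg hτ h0 hp le_rfl hτR
      (fun r hr => hvneg r hr.1)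
    rw [h.scalingWronskian_eq_zero hτ h0] at hWR
    refine hWR.not_ge (ge_of_tendsto hlim ?_)
    filter_upwards [eventually_gt_atTop R] with r hr
    exact (h.scalingWronskian_strictMono hv hneg hτ h0 hp hτR.le hr
      (fun x hx => hvneg x (hτR.trans hx.1))).le

end GroundState

/-- for a ground state, the variation `v` changes sign exactly once, at some
`τ₁ ∈ (0, r₁)`, stays negative afterwards, and tends to `-∞`. -/
theorem statement18 (n : ℕ) (hn : 3 ≤ n) (p : ℝ) (hp1 : 1 < p)
    (hp2 : p < ((n : ℝ) + 2) / ((n : ℝ) - 2))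
    (α : ℝ) (hα : 0 < α)
    (u u' u'' v v' v'' : ℝ → ℝ)
    (hu : IsSolution n p α u u' u'') (hv : IsVariation n p u v v' v'')
    (hdec : Decaying u u') (hpos : ∀ r : ℝ, 0 ≤ r → 0 < u r)
    (r₁ : ℝ) (hr₁ : 0 < r₁) (hur₁ : u r₁ = 1)
    (huniq : ∀ r : ℝ, 0 < r → u r = 1 → r = r₁) :
    ∃ τ₁ : ℝ, 0 < τ₁ ∧ τ₁ < r₁ ∧
      (∀ r : ℝ, 0 ≤ r → r < τ₁ → 0 < v r) ∧ v τ₁ = 0 ∧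
      (∀ r : ℝ, τ₁ < r → v r < 0) ∧
      Filter.Tendsto v Filter.atTop Filter.atBot := by
  have hcast : ((n - 1 : ℕ) : ℝ) = (n : ℝ) - 1 := by
    rw [Nat.cast_sub (by omega), Nat.cast_one]
  have hg : GroundState (n - 1) p u u' :=
    { one_lt := hp1
      two_le := by omega
      deriv_zero := hu.initDeriv
      cont := fun r hr => (hu.hasDeriv1 r hr).continuousWithinAt
      cont_deriv := fun r hr => (hu.hasDeriv2 r hr).continuousWithinAt
      hasDerivAt := fun r hr => (hu.hasDeriv1 r hr.le).hasDerivAt (Ici_mem_nhds hr)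
      hasDerivAt_deriv := fun r hr => by
        refine ((hu.hasDeriv2 r hr.le).hasDerivAt (Ici_mem_nhds hr)).congr_deriv ?_
        have h1 := hu.ode r hr
        rw [f, abs_of_pos (hpos r hr.le)] at h1
        rw [hcast]
        linarith
      pos := hpos
      tendsto := hdec.1
      tendsto_deriv := hdec.2 }
  have hl : LinearizedSolution (n - 1) p u v v' :=
    { init := hv.init
      cont := fun r hr => (hv.hasDeriv1 r hr).continuousWithinAt
      cont_deriv := fun r hr => (hv.hasDeriv2 r hr).continuousWithinAt
      hasDerivAt := fun r hr => (hv.hasDeriv1 r hr.le).hasDerivAt (Ici_mem_nhds hr)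
      hasDerivAt_deriv := fun r hr => by
        refine ((hv.hasDeriv2 r hr.le).hasDerivAt (Ici_mem_nhds hr)).congr_deriv ?_
        have h1 := hv.ode r hr
        rw [fder, abs_of_pos (hpos r hr.le)] at h1
        rw [hcast]
        linarith }
  have hneg : ∀ r, 0 < r → u' r < 0 := fun r hr => hg.deriv_neg hr₁ huniq hr
  obtain ⟨b, hb0, hb1, hb⟩ := hg.exists_nonpos hl hr₁ hur₁ hneg
  obtain ⟨τ, hτ0, hτb, hτ, hτpos⟩ := exists_first_zero hb0.le (hl.cont.mono fun x hx => hx.1)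
    (by rw [hl.init]; exact one_pos) hb
  exact ⟨τ, hτ0, hτb.trans_lt hb1, hτpos, hτ,
    fun r hr => hg.neg_of_first_zero hl hneg hτ0 hτ hτpos hr,
    hg.tendsto_atBot hl hneg hτ0 hτ hτpos⟩
end
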